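/- arXiv:math/0201215 — 3 statements merged into one kernel-verified Lean document; each statement's English description precedes it below -/
import Mathlib

section
/- Let n ≥ 1 and let F : ℝⁿ → ℝ be a smooth convex function (D²F(x) positive semidefinite for all x) that is an entire solution of the special Lagrangian equation ∑ᵢ arctan λᵢ(x) = constant, where λ₁(x), …, λₙ(x) are the eigenvalues of D²F(x). Then F is a quadratic polynomial. -/
open Matrix

/-- The Hessian matrix of `F : ℝⁿ → ℝ` at `x`, with entries `∂²F/∂xⁱ∂xʲ (x)`. -/
noncomputable def Hess (n : ℕ) (F : (Fin n → ℝ) → ℝ) (x : Fin n → ℝ) :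
    Matrix (Fin n) (Fin n) ℝ :=
  fun i j => fderiv ℝ (fun y => fderiv ℝ F y (Pi.single j 1)) x (Pi.single i 1)

namespace SpecialLagrangian

open scoped ContDiff Matrix.Norms.Operator

section Determinant

variable {ι 𝔸 : Type*} [Fintype ι] [DecidableEq ι] [NormedCommRing 𝔸] [NormedAlgebra ℝ 𝔸]

/-- **Jacobi's formula** for the derivative of a determinant along a curve of matrices. -/
theorem hasDerivAt_det {M : ℝ → Matrix ι ι 𝔸} {M' : Matrix ι ι 𝔸} {t : ℝ}
    (h : ∀ i j, HasDerivAt (fun s => M s i j) (M' i j) t) :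
    HasDerivAt (fun s => (M s).det) (trace ((M t).adjugate * M')) t := by
  have key : trace ((M t).adjugate * M') = ∑ i, ((M t).updateCol i (fun j => M' j i)).det := by
    simp only [trace, diag, mul_apply]
    refine Finset.sum_congr rfl fun i _ => ?_
    rw [← Matrix.cramer_apply, Matrix.cramer_eq_adjugate_mulVec]
    simp [mulVec, dotProduct]
  rw [key]
  simp only [det_apply']
  rw [Finset.sum_comm]
  refine HasDerivAt.fun_sum fun σ _ => ?_
  rw [← Finset.mul_sum]
  refine HasDerivAt.const_mul _ ?_
  convert HasDerivAt.fun_finsetProd (u := Finset.univ) (f := fun i s => M s (σ i) i)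
    (f' := fun i => M' (σ i) i) (x := t) fun i _ => h (σ i) i using 1
  refine Finset.sum_congr rfl fun i _ => ?_
  rw [← Finset.mul_prod_erase Finset.univ _ (Finset.mem_univ i), smul_eq_mul, mul_comm]
  congr 1
  · refine Finset.prod_congr rfl fun j hj => ?_
    simp [Finset.ne_of_mem_erase hj]
  · simp

end Determinant

section MatrixValued

variable {n : ℕ} {W : Type*} [NormedAddCommGroup W] [NormedSpace ℝ W]

theorem contDiff_matrix_iff {M : W → Matrix (Fin n) (Fin n) ℝ} {k : WithTop ℕ∞} :
    ContDiff ℝ k M ↔ ∀ i j, ContDiff ℝ k (fun x => M x i j) := by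
  constructor
  · intro h i j
    exact (LinearMap.toContinuousLinearMap (Matrix.entryLinearMap ℝ ℝ i j)).contDiff.comp h
  · intro h
    have : M = fun x => ∑ i, ∑ j, M x i j • Matrix.single i j (1 : ℝ) := by
      funext x
      conv_lhs => rw [matrix_eq_sum_single (M x)]
      simp [Matrix.smul_single]
    rw [this]
    exact ContDiff.sum fun i _ => ContDiff.sum fun j _ => (h i j).smul contDiff_const

/-- The partial derivative in the `k`-th coordinate direction. -/
noncomputable def pd {n : ℕ} {W : Type*} [NormedAddCommGroup W] [NormedSpace ℝ W]
    (k : Fin n) (f : (Fin n → ℝ) → W) (x : Fin n → ℝ) : W :=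
  fderiv ℝ f x (Pi.single k 1)

theorem pd_entry {M : (Fin n → ℝ) → Matrix (Fin n) (Fin n) ℝ} {x : Fin n → ℝ}
    (hM : DifferentiableAt ℝ M x) (k i j : Fin n) :
    pd k (fun y => M y i j) x = pd k M x i j := by
  have := (LinearMap.toContinuousLinearMap
    (Matrix.entryLinearMap ℝ ℝ i j)).hasFDerivAt.comp x hM.hasFDerivAt
  have h2 : HasFDerivAt (fun y => M y i j) _ x := this
  rw [pd, h2.fderiv]
  rfl

theorem _root_.DifferentiableAt.matrix_entry {M : W → Matrix (Fin n) (Fin n) ℝ} {x : W}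
    (hM : DifferentiableAt ℝ M x) (i j : Fin n) : DifferentiableAt ℝ (fun y => M y i j) x :=
  ((LinearMap.toContinuousLinearMap
    (Matrix.entryLinearMap ℝ ℝ i j)).hasFDerivAt.comp x hM.hasFDerivAt).differentiableAt

theorem pd_hasDerivAt {f : (Fin n → ℝ) → W} {x : Fin n → ℝ} (hf : DifferentiableAt ℝ f x)
    (k : Fin n) : HasDerivAt (fun t : ℝ => f (x + t • Pi.single k 1)) (pd k f x) 0 :=
  hf.hasFDerivAt.hasLineDerivAt _

theorem pd_eq_of_hasDerivAt {f : (Fin n → ℝ) → W} {x : Fin n → ℝ} (hf : DifferentiableAt ℝ f x)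
    {k : Fin n} {f' : W} (h : HasDerivAt (fun t : ℝ => f (x + t • Pi.single k 1)) f' 0) :
    pd k f x = f' :=
  (pd_hasDerivAt hf k).unique h

theorem contDiff_pd {f : (Fin n → ℝ) → W} (hf : ContDiff ℝ ∞ f) (k : Fin n) :
    ContDiff ℝ ∞ (pd k f) :=
  (hf.fderiv_right (m := ∞) (by simp)).clm_apply contDiff_const

theorem pd_comm {f : (Fin n → ℝ) → W} (hf : ContDiff ℝ ∞ f) (i j : Fin n) (x : Fin n → ℝ) :
    pd i (pd j f) x = pd j (pd i f) x := by
  have h2 : DifferentiableAt ℝ (fderiv ℝ f) x :=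
    ((hf.fderiv_right (m := ∞) (by simp)).differentiable (by simp)) x
  have aux (i j : Fin n) :
      pd i (pd j f) x = fderiv ℝ (fderiv ℝ f) x (Pi.single i 1) (Pi.single j 1) := by
    unfold pd
    rw [fderiv_clm_apply h2 (differentiableAt_const _)]
    simp
  rw [aux, aux]
  exact ((hf.of_le (m := 2) ENat.LEInfty.out).contDiffAt.isSymmSndFDerivAt (by simp)) _ _

theorem pd_matrix_mul {M N : (Fin n → ℝ) → Matrix (Fin n) (Fin n) ℝ} {x : Fin n → ℝ}
    (hM : DifferentiableAt ℝ M x) (hN : DifferentiableAt ℝ N x) (k : Fin n) :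
    pd k (fun y => M y * N y) x = M x * pd k N x + pd k M x * N x := by
  unfold pd
  rw [fderiv_fun_mul' hM hN]
  simp

theorem pd_mul {f g : (Fin n → ℝ) → ℝ} {x : Fin n → ℝ}
    (hf : DifferentiableAt ℝ f x) (hg : DifferentiableAt ℝ g x) (k : Fin n) :
    pd k (fun y => f y * g y) x = f x * pd k g x + pd k f x * g x := by
  unfold pd
  rw [fderiv_fun_mul hf hg]
  simp [mul_comm]

theorem pd_sum {ι : Type*} {s : Finset ι} {f : ι → (Fin n → ℝ) → W} {x : Fin n → ℝ}
    (hf : ∀ i ∈ s, DifferentiableAt ℝ (f i) x) (k : Fin n) :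
    pd k (fun y => ∑ i ∈ s, f i y) x = ∑ i ∈ s, pd k (f i) x := by
  unfold pd
  rw [fderiv_fun_sum hf]
  simp

theorem contDiff_matrix_inv {M : W → Matrix (Fin n) (Fin n) ℝ} {k : WithTop ℕ∞}
    (hM : ContDiff ℝ k M) (hu : ∀ x, IsUnit (M x)) : ContDiff ℝ k (fun x => (M x)⁻¹) := by
  simp_rw [nonsing_inv_eq_ringInverse]
  refine contDiff_iff_contDiffAt.2 fun x => ?_
  obtain ⟨u, hu⟩ := hu x
  exact ContDiffAt.comp x (hu ▸ contDiffAt_ringInverse ℝ u) hM.contDiffAt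

theorem pd_matrix_inv {M : (Fin n → ℝ) → Matrix (Fin n) (Fin n) ℝ}
    (hM : ContDiff ℝ ∞ M) (hu : ∀ x, IsUnit (M x)) (k : Fin n) (x : Fin n → ℝ) :
    pd k (fun y => (M y)⁻¹) x = - ((M x)⁻¹ * pd k M x * (M x)⁻¹) := by
  have hd : DifferentiableAt ℝ M x := hM.differentiable (by simp) x
  have hdi : DifferentiableAt ℝ (fun y => (M y)⁻¹) x :=
    (contDiff_matrix_inv hM hu).differentiable (by simp) x
  have h1 : pd k (fun y => M y * (M y)⁻¹) x = 0 := by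
    have : (fun y => M y * (M y)⁻¹) = fun _ => 1 := by
      funext y
      exact mul_nonsing_inv _ ((isUnit_iff_isUnit_det _).1 (hu y))
    rw [this]; simp [pd]
  rw [pd_matrix_mul hd hdi] at h1
  have hdet := (isUnit_iff_isUnit_det _).1 (hu x)
  have := congrArg (fun Z => (M x)⁻¹ * Z) h1
  simp only [mul_add, ← mul_assoc, nonsing_inv_mul _ hdet, one_mul, mul_zero] at this
  exact eq_neg_of_add_eq_zero_left this

theorem contDiff_det {M : W → Matrix (Fin n) (Fin n) ℝ} {k : WithTop ℕ∞}
    (hM : ∀ i j, ContDiff ℝ k (fun x => M x i j)) : ContDiff ℝ k (fun x => (M x).det) := by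
  simp only [det_apply']
  exact ContDiff.sum fun σ _ => contDiff_const.mul (contDiff_prod fun i _ => hM _ _)

theorem pd_det {M : (Fin n → ℝ) → Matrix (Fin n) (Fin n) ℝ}
    (hM : ContDiff ℝ ∞ M) (k : Fin n) (x : Fin n → ℝ) :
    pd k (fun y => (M y).det) x = trace ((M x).adjugate * pd k M x) := by
  have hd : DifferentiableAt ℝ M x := hM.differentiable (by simp) x
  refine pd_eq_of_hasDerivAt
    ((contDiff_det (contDiff_matrix_iff.1 hM)).differentiable (by simp) x) ?_
  have := hasDerivAt_det (M := fun t : ℝ => M (x + t • Pi.single k 1)) (M' := pd k M x) (t := 0)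
    fun i j => by
      rw [← pd_entry hd]
      exact pd_hasDerivAt (hd.matrix_entry i j) k
  simpa using this

end MatrixValued

end SpecialLagrangian

namespace SpecialLagrangian

open scoped ContDiff Matrix.Norms.Operator

variable {n : ℕ}

/-- The Jacobian matrix `(∂ᵢ qⱼ)ᵢⱼ` of a map `q : ℝⁿ → ℝⁿ`. -/
noncomputable def jac (q : (Fin n → ℝ) → (Fin n → ℝ)) (x : Fin n → ℝ) :
    Matrix (Fin n) (Fin n) ℝ :=
  of fun i j => pd i (fun y => q y j) x

/-- The graph of `q` is a special Lagrangian submanifold of `ℝⁿ × ℝⁿ`, whose tangent planes make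
angles at most `π / 4` with `ℝⁿ × 0`. -/
structure IsSLGraph (q : (Fin n → ℝ) → (Fin n → ℝ)) : Prop where
  smooth : ContDiff ℝ ∞ q
  symm : ∀ x, (jac q x)ᵀ = jac q x
  bdd : ∀ x, (1 - jac q x * jac q x).PosSemidef
  minimal : ∀ k x, trace ((1 + jac q x * jac q x)⁻¹ * pd k (jac q) x) = 0

/-- The inverse of the metric induced on the graph of `q`. -/
noncomputable def ginv (q : (Fin n → ℝ) → (Fin n → ℝ)) (x : Fin n → ℝ) :
    Matrix (Fin n) (Fin n) ℝ :=
  (1 + jac q x * jac q x)⁻¹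

/-- The volume density of the graph of `q`. -/
noncomputable def vol (q : (Fin n → ℝ) → (Fin n → ℝ)) (x : Fin n → ℝ) : ℝ :=
  √(1 + jac q x * jac q x).det

/-- The Laplacian of the graph of `q`, in nondivergence form. -/
noncomputable def lap (q : (Fin n → ℝ) → (Fin n → ℝ)) (f : (Fin n → ℝ) → ℝ) (x : Fin n → ℝ) : ℝ :=
  ∑ i, ∑ j, ginv q x i j * pd i (pd j f) x

theorem posDef_one_add_mul_self {H : Matrix (Fin n) (Fin n) ℝ} (hH : Hᵀ = H) :
    (1 + H * H).PosDef := by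
  have h := Matrix.posSemidef_conjTranspose_mul_self H
  rw [conjTranspose_eq_transpose_of_trivial, hH] at h
  exact Matrix.PosDef.one.add_posSemidef h

theorem isUnit_one_add_mul_self {H : Matrix (Fin n) (Fin n) ℝ} (hH : Hᵀ = H) :
    IsUnit (1 + H * H) :=
  (posDef_one_add_mul_self hH).isUnit

theorem inv_mul_comm_self {H : Matrix (Fin n) (Fin n) ℝ} (hH : Hᵀ = H) :
    (1 + H * H)⁻¹ * H = H * (1 + H * H)⁻¹ := by
  have hu := (isUnit_iff_isUnit_det _).1 (isUnit_one_add_mul_self hH)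
  calc (1 + H * H)⁻¹ * H = (1 + H * H)⁻¹ * (H * (1 + H * H)) * (1 + H * H)⁻¹ := by
        rw [mul_assoc, mul_assoc, mul_nonsing_inv _ hu, mul_one]
    _ = (1 + H * H)⁻¹ * ((1 + H * H) * H) * (1 + H * H)⁻¹ := by
        congr 2; noncomm_ring
    _ = H * (1 + H * H)⁻¹ := by
        rw [← mul_assoc, nonsing_inv_mul _ hu, one_mul]

theorem sum_mul_mul_apply {T : Fin n → Matrix (Fin n) (Fin n) ℝ}
    (h1 : ∀ k i j, T k i j = T k j i) (h2 : ∀ k i j, T k i j = T i k j)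
    (M N : Matrix (Fin n) (Fin n) ℝ) (j : Fin n) :
    ∑ i, (M * T i * N) i j = ∑ b, trace (M * T b) * N b j := by
  simp only [mul_apply, trace, diag, Finset.sum_mul]
  rw [Finset.sum_comm]
  refine Finset.sum_congr rfl fun b _ => Finset.sum_congr rfl fun i _ =>
    Finset.sum_congr rfl fun a _ => ?_
  rw [h1 i a b, h2 i b a, h1 b i a]

namespace IsSLGraph

variable {q : (Fin n → ℝ) → (Fin n → ℝ)}

theorem smooth_apply (hq : IsSLGraph q) (j : Fin n) : ContDiff ℝ ∞ (fun y => q y j) :=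
  contDiff_pi.1 hq.smooth j

theorem contDiff_jac (hq : IsSLGraph q) : ContDiff ℝ ∞ (jac q) :=
  contDiff_matrix_iff.2 fun i j => contDiff_pd (hq.smooth_apply j) i

theorem contDiff_jac_apply (hq : IsSLGraph q) (i j : Fin n) : ContDiff ℝ ∞ (fun y => jac q y i j) :=
  contDiff_matrix_iff.1 hq.contDiff_jac i j

theorem differentiable_jac (hq : IsSLGraph q) : Differentiable ℝ (jac q) :=
  hq.contDiff_jac.differentiable (by simp)

theorem contDiff_metric (hq : IsSLGraph q) : ContDiff ℝ ∞ (fun x => 1 + jac q x * jac q x) :=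
  contDiff_const.add (hq.contDiff_jac.mul hq.contDiff_jac)

theorem contDiff_ginv (hq : IsSLGraph q) : ContDiff ℝ ∞ (ginv q) :=
  contDiff_matrix_inv hq.contDiff_metric fun x => isUnit_one_add_mul_self (hq.symm x)

theorem contDiff_ginv_apply (hq : IsSLGraph q) (i j : Fin n) :
    ContDiff ℝ ∞ (fun y => ginv q y i j) :=
  contDiff_matrix_iff.1 hq.contDiff_ginv i j

theorem det_metric_pos (hq : IsSLGraph q) (x : Fin n → ℝ) :
    0 < (1 + jac q x * jac q x).det :=
  (posDef_one_add_mul_self (hq.symm x)).det_pos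

theorem vol_pos (hq : IsSLGraph q) (x : Fin n → ℝ) : 0 < vol q x :=
  Real.sqrt_pos.2 (hq.det_metric_pos x)

theorem contDiff_vol (hq : IsSLGraph q) : ContDiff ℝ ∞ (vol q) :=
  (contDiff_det (contDiff_matrix_iff.1 hq.contDiff_metric)).sqrt fun x => (hq.det_metric_pos x).ne'

theorem pd_jac_symm (hq : IsSLGraph q) (x : Fin n → ℝ) (k i j : Fin n) :
    pd k (jac q) x i j = pd k (jac q) x j i := by
  rw [← pd_entry (hq.differentiable_jac x), ← pd_entry (hq.differentiable_jac x)]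
  congr 1
  funext y
  conv_lhs => rw [← hq.symm y]
  rfl

theorem pd_jac_comm (hq : IsSLGraph q) (x : Fin n → ℝ) (k i j : Fin n) :
    pd k (jac q) x i j = pd i (jac q) x k j := by
  rw [← pd_entry (hq.differentiable_jac x), ← pd_entry (hq.differentiable_jac x)]
  exact pd_comm (hq.smooth_apply j) k i x

theorem pd_metric (hq : IsSLGraph q) (k : Fin n) (x : Fin n → ℝ) :
    pd k (fun x => 1 + jac q x * jac q x) x =
      jac q x * pd k (jac q) x + pd k (jac q) x * jac q x := by
  have : pd k (fun x => 1 + jac q x * jac q x) x = pd k (fun x => jac q x * jac q x) x := by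
    unfold pd
    rw [fderiv_const_add]
  rw [this, pd_matrix_mul (hq.differentiable_jac x) (hq.differentiable_jac x)]

theorem pd_ginv (hq : IsSLGraph q) (k : Fin n) (x : Fin n → ℝ) :
    pd k (ginv q) x = - (ginv q x * (jac q x * pd k (jac q) x + pd k (jac q) x * jac q x)
      * ginv q x) := by
  rw [← hq.pd_metric]
  exact pd_matrix_inv hq.contDiff_metric (fun x => isUnit_one_add_mul_self (hq.symm x)) k x

theorem ginv_mul_jac (hq : IsSLGraph q) (x : Fin n → ℝ) :
    ginv q x * jac q x = jac q x * ginv q x :=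
  inv_mul_comm_self (hq.symm x)

theorem ginv_symm (hq : IsSLGraph q) (x : Fin n → ℝ) : (ginv q x)ᵀ = ginv q x := by
  rw [ginv, transpose_nonsing_inv]
  simp [hq.symm x]

theorem trace_ginv_mul_pd (hq : IsSLGraph q) (k : Fin n) (x : Fin n → ℝ) :
    trace (ginv q x * pd k (jac q) x) = 0 :=
  hq.minimal k x

theorem pd_vol (hq : IsSLGraph q) (k : Fin n) (x : Fin n → ℝ) :
    pd k (vol q) x = vol q x * trace (ginv q x * jac q x * pd k (jac q) x) := by
  have hD : DifferentiableAt ℝ (fun x => (1 + jac q x * jac q x).det) x :=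
    (contDiff_det (contDiff_matrix_iff.1 hq.contDiff_metric)).differentiable (by simp) x
  have h1 : pd k (vol q) x = 1 / (2 * vol q x) * pd k (fun x => (1 + jac q x * jac q x).det) x := by
    have := (hD.hasFDerivAt.sqrt (hq.det_metric_pos x).ne').fderiv
    unfold pd
    unfold vol
    rw [this]
    simp
  have h2 : (1 + jac q x * jac q x).adjugate = (vol q x) ^ 2 • ginv q x := by
    rw [ginv, inv_def, vol, Real.sq_sqrt (hq.det_metric_pos x).le, smul_smul,
      Ring.inverse_eq_inv', mul_inv_cancel₀ (hq.det_metric_pos x).ne', one_smul]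
  have h3 : trace (ginv q x * (pd k (jac q) x * jac q x)) =
      trace (ginv q x * jac q x * pd k (jac q) x) := by
    rw [← mul_assoc, trace_mul_comm, ← mul_assoc, hq.ginv_mul_jac]
  rw [h1, pd_det hq.contDiff_metric, hq.pd_metric, h2, smul_mul_assoc, trace_smul, mul_add,
    trace_add, h3, ← mul_assoc]
  have := (hq.vol_pos x).ne'
  simp only [smul_eq_mul]
  field_simp
  ring

/-- The coordinate functions are harmonic on a special Lagrangian graph. -/
theorem sum_pd_vol_mul_ginv (hq : IsSLGraph q) (j : Fin n) (x : Fin n → ℝ) :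
    ∑ i, pd i (fun y => vol q y * ginv q y i j) x = 0 := by
  have h0 (i : Fin n) : pd i (fun y => vol q y * ginv q y i j) x =
      vol q x * (trace (ginv q x * jac q x * pd i (jac q) x) * ginv q x i j
        - (ginv q x * jac q x * pd i (jac q) x * ginv q x) i j
        - (ginv q x * pd i (jac q) x * (jac q x * ginv q x)) i j) := by
    rw [pd_mul (hq.contDiff_vol.differentiable (by simp) x)
      ((hq.contDiff_ginv_apply i j).differentiable (by simp) x), hq.pd_vol,
      pd_entry (hq.contDiff_ginv.differentiable (by simp) x), hq.pd_ginv]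
    rw [mul_add, add_mul]
    simp only [Matrix.neg_apply, Matrix.add_apply, ← mul_assoc]
    ring
  simp_rw [h0]
  rw [← Finset.mul_sum, Finset.sum_sub_distrib, Finset.sum_sub_distrib,
    sum_mul_mul_apply (hq.pd_jac_symm x) (hq.pd_jac_comm x),
    sum_mul_mul_apply (hq.pd_jac_symm x) (hq.pd_jac_comm x)]
  simp [hq.trace_ginv_mul_pd]

theorem lap_jac (hq : IsSLGraph q) (a b : Fin n) (x : Fin n → ℝ) :
    lap q (fun y => jac q y a b) x = trace (ginv q x * (jac q x * pd b (jac q) x +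
      pd b (jac q) x * jac q x) * ginv q x * pd a (jac q) x) := by
  have hT (k : Fin n) : DifferentiableAt ℝ (pd k (jac q)) x :=
    (contDiff_pd hq.contDiff_jac k).differentiable (by simp) x
  have hG : DifferentiableAt ℝ (ginv q) x := hq.contDiff_ginv.differentiable (by simp) x
  have h1 (i j : Fin n) : pd i (pd j fun y => jac q y a b) x = pd b (pd a (jac q)) x j i := by
    have e1 : (pd j fun y => jac q y a b) = pd b fun y => jac q y j a := by
      funext y
      rw [pd_entry (hq.differentiable_jac y), pd_entry (hq.differentiable_jac y),
        hq.pd_jac_symm, hq.pd_jac_comm]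
    have e2 : (pd i fun y => jac q y j a) = fun y => pd a (jac q) y j i := by
      funext y
      rw [pd_entry (hq.differentiable_jac y), hq.pd_jac_symm, hq.pd_jac_comm, hq.pd_jac_symm]
    rw [e1, pd_comm (hq.contDiff_jac_apply _ _), e2, pd_entry (hT a)]
  have h2 : trace (ginv q x * pd b (pd a (jac q)) x + pd b (ginv q) x * pd a (jac q) x) = 0 := by
    rw [← pd_matrix_mul hG (hT a)]
    have hz : (fun y => trace (ginv q y * pd a (jac q) y)) = fun _ => 0 :=
      funext fun y => hq.trace_ginv_mul_pd a y
    have hd : DifferentiableAt ℝ (fun y => ginv q y * pd a (jac q) y) x := hG.mul (hT a)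
    have : pd b (fun y => trace (ginv q y * pd a (jac q) y)) x =
        trace (pd b (fun y => ginv q y * pd a (jac q) y) x) := by
      simp only [trace, diag]
      rw [pd_sum fun i _ => hd.matrix_entry i i]
      exact Finset.sum_congr rfl fun i _ => pd_entry hd b i i
    rw [← this, hz]
    simp [pd]
  rw [trace_add, hq.pd_ginv, neg_mul, trace_neg] at h2
  rw [← sub_eq_zero, sub_eq_add_neg, ← h2]
  congr 1
  simp only [lap, h1, trace, diag, mul_apply]

theorem pd_apply_self (k i : Fin n) (x : Fin n → ℝ) :
    pd k (fun y : Fin n → ℝ => y i) x = if k = i then 1 else 0 := by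
  have := (ContinuousLinearMap.proj (R := ℝ) (φ := fun _ : Fin n => ℝ) i).hasFDerivAt (x := x)
  have h2 : HasFDerivAt (fun y : Fin n → ℝ => y i) _ x := this
  rw [pd, h2.fderiv]
  simp [Pi.single_apply, eq_comm]

theorem lap_mul_self {f : (Fin n → ℝ) → ℝ} (hf : ContDiff ℝ ∞ f) (x : Fin n → ℝ) :
    lap q (fun y => f y * f y) x =
      2 * f x * lap q f x + 2 * ∑ i, ∑ j, ginv q x i j * (pd i f x * pd j f x) := by
  have hd : Differentiable ℝ f := hf.differentiable (by simp)
  have h1 (i j : Fin n) : pd i (pd j fun y => f y * f y) x =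
      2 * (f x * pd i (pd j f) x + pd i f x * pd j f x) := by
    have : (pd j fun y => f y * f y) = fun y => 2 * (f y * pd j f y) := by
      funext y
      rw [pd_mul (hd y) (hd y)]
      ring
    rw [this]
    have hj : DifferentiableAt ℝ (pd j f) x := (contDiff_pd hf j).differentiable (by simp) x
    rw [pd_mul (g := fun y => f y * pd j f y) (differentiableAt_const _) ((hd x).mul hj),
      pd_mul (hd x) hj]
    simp [pd]
  simp only [lap, h1, Finset.mul_sum, ← Finset.sum_add_distrib]
  refine Finset.sum_congr rfl fun i _ => Finset.sum_congr rfl fun j _ => ?_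
  ring

theorem lap_sum {ι : Type*} {s : Finset ι} {f : ι → (Fin n → ℝ) → ℝ}
    (hf : ∀ a ∈ s, ContDiff ℝ ∞ (f a)) (x : Fin n → ℝ) :
    lap q (fun y => ∑ a ∈ s, f a y) x = ∑ a ∈ s, lap q (f a) x := by
  have h1 (i j : Fin n) : pd i (pd j fun y => ∑ a ∈ s, f a y) x = ∑ a ∈ s, pd i (pd j (f a)) x := by
    have : (pd j fun y => ∑ a ∈ s, f a y) = fun y => ∑ a ∈ s, pd j (f a) y := by
      funext y
      exact pd_sum (fun a ha => (hf a ha).differentiable (by simp) y) j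
    rw [this]
    exact pd_sum (fun a ha => (contDiff_pd (hf a ha) j).differentiable (by simp) x) i
  simp only [lap, h1, Finset.mul_sum]
  rw [Finset.sum_comm' (t' := Finset.univ) (s' := fun _ => Finset.univ) (by simp)]
  conv_rhs => rw [Finset.sum_comm]
  rw [Finset.sum_comm]
  refine Finset.sum_congr rfl fun i _ => ?_
  rw [Finset.sum_comm]

end IsSLGraph

/-- The squared distance in `ℝⁿ × ℝⁿ` of the point `(x, q x)` to the origin. -/
noncomputable def distSq (q : (Fin n → ℝ) → (Fin n → ℝ)) (x : Fin n → ℝ) : ℝ :=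
  ∑ k, (x k * x k + q x k * q x k)

namespace IsSLGraph

variable {q : (Fin n → ℝ) → (Fin n → ℝ)}

theorem contDiff_coord (k : Fin n) : ContDiff ℝ ∞ (fun y : Fin n → ℝ => y k) :=
  contDiff_apply ℝ ℝ k

theorem contDiff_distSq (hq : IsSLGraph q) : ContDiff ℝ ∞ (distSq q) :=
  ContDiff.sum fun k _ => ((contDiff_coord k).mul (contDiff_coord k)).add
    ((hq.smooth_apply k).mul (hq.smooth_apply k))

theorem lap_coord (k : Fin n) (x : Fin n → ℝ) : lap q (fun y => y k) x = 0 := by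
  have (j : Fin n) : (pd j fun y : Fin n → ℝ => y k) = fun _ => if j = k then 1 else 0 :=
    funext fun y => pd_apply_self j k y
  simp only [lap, this]
  simp [pd]

theorem lap_apply (hq : IsSLGraph q) (k : Fin n) (x : Fin n → ℝ) :
    lap q (fun y => q y k) x = 0 := by
  rw [← hq.trace_ginv_mul_pd k x]
  simp only [lap, trace, diag, mul_apply]
  refine Finset.sum_congr rfl fun i _ => Finset.sum_congr rfl fun j _ => ?_
  have : (pd j fun y => q y k) = fun y => jac q y j k := rfl
  rw [this, pd_entry (hq.differentiable_jac x), hq.pd_jac_symm, hq.pd_jac_comm, hq.pd_jac_symm]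

theorem lap_add {f g : (Fin n → ℝ) → ℝ} (hf : ContDiff ℝ ∞ f) (hg : ContDiff ℝ ∞ g)
    (x : Fin n → ℝ) : lap q (fun y => f y + g y) x = lap q f x + lap q g x := by
  have := lap_sum (q := q) (s := Finset.univ) (f := ![f, g])
    (by simp [Fin.forall_fin_two, hf, hg]) x
  simpa [Fin.sum_univ_two] using this

theorem lap_distSq (hq : IsSLGraph q) (x : Fin n → ℝ) : lap q (distSq q) x = 2 * n := by
  have h0 (k : Fin n) : lap q (fun y => y k * y k + q y k * q y k) x =
      2 * ∑ i, ∑ j, ginv q x i j * ((if i = k then 1 else 0) * (if j = k then 1 else 0)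
        + jac q x i k * jac q x j k) := by
    rw [lap_add ((contDiff_coord k).mul (contDiff_coord k))
      ((hq.smooth_apply k).mul (hq.smooth_apply k)), lap_mul_self (contDiff_coord k),
      lap_mul_self (hq.smooth_apply k), lap_coord, hq.lap_apply]
    simp only [mul_zero, zero_add, ← mul_add, ← Finset.sum_add_distrib, pd_apply_self]
    rfl
  unfold distSq
  rw [lap_sum fun k _ => ((contDiff_coord k).mul (contDiff_coord k)).add
    ((hq.smooth_apply k).mul (hq.smooth_apply k))]
  simp_rw [h0]
  rw [← Finset.mul_sum]
  congr 1
  have h1 : trace (ginv q x * (1 + jac q x * jac q x)) = (n : ℝ) := by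
    rw [ginv, nonsing_inv_mul _ ((isUnit_iff_isUnit_det _).1 (isUnit_one_add_mul_self (hq.symm x)))]
    simp
  rw [← h1]
  simp only [trace, diag, mul_apply, Matrix.add_apply]
  rw [Finset.sum_comm]
  refine Finset.sum_congr rfl fun i _ => ?_
  rw [Finset.sum_comm]
  refine Finset.sum_congr rfl fun j _ => ?_
  rw [← Finset.mul_sum, Finset.sum_add_distrib]
  congr 2
  · simp [Matrix.one_apply, eq_comm]
  · refine Finset.sum_congr rfl fun k _ => ?_
    have := congrFun (congrFun (hq.symm x) k) i
    rw [transpose_apply] at this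
    rw [this, mul_comm]

end IsSLGraph

end SpecialLagrangian

namespace SpecialLagrangian

open scoped ContDiff Matrix.Norms.Operator

variable {n : ℕ}

theorem weight_ge {x y z : ℝ} (hx : x * x ≤ 1) (hy : y * y ≤ 1) (hz : z * z ≤ 1) :
    1 / 4 ≤ ((1 + x * x)⁻¹ + (1 + y * y)⁻¹ * (y + z) * (1 + z * z)⁻¹ * x) +
      ((1 + y * y)⁻¹ + (1 + z * z)⁻¹ * (z + x) * (1 + x * x)⁻¹ * y) +
      ((1 + z * z)⁻¹ + (1 + x * x)⁻¹ * (x + y) * (1 + y * y)⁻¹ * z) := by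
  have hx' := abs_le.1 (abs_le_one_iff_mul_self_le_one.2 hx)
  have hy' := abs_le.1 (abs_le_one_iff_mul_self_le_one.2 hy)
  have hz' := abs_le.1 (abs_le_one_iff_mul_self_le_one.2 hz)
  have ex : 0 < 1 + x * x := by nlinarith
  have ey : 0 < 1 + y * y := by nlinarith
  have ez : 0 < 1 + z * z := by nlinarith
  have aux {a b : ℝ} (ha : -1 ≤ a ∧ a ≤ 1) (hb : -1 ≤ b ∧ b ≤ 1) :
      1 + a * b ≤ (1 + a * b) * (1 + a * b + a * a + b * b) := by
    have h1 : 0 ≤ 1 + a * b := by nlinarith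
    have h2 : 0 ≤ a * b + a * a + b * b := by nlinarith [sq_nonneg (a + b), sq_nonneg a]
    nlinarith [mul_nonneg h1 h2]
  have h3 : 0 ≤ (1 + x) * (1 + y) * (1 + z) + (1 - x) * (1 - y) * (1 - z) := by
    have := hx'.1; have := hx'.2; have := hy'.1; have := hy'.2; have := hz'.1; have := hz'.2
    have h1 : 0 ≤ (1 + x) * (1 + y) * (1 + z) :=
      mul_nonneg (mul_nonneg (by linarith) (by linarith)) (by linarith)
    have h2 : 0 ≤ (1 - x) * (1 - y) * (1 - z) :=
      mul_nonneg (mul_nonneg (by linarith) (by linarith)) (by linarith)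
    linarith
  have h4 : (1 + x * x) * (1 + y * y) * (1 + z * z) ≤ 8 := by
    have : (1 + x * x) * (1 + y * y) ≤ 4 := by nlinarith
    nlinarith
  have h5 := aux hx' hy'
  have h6 := aux hy' hz'
  have h7 := aux hz' hx'
  rw [← sub_nonneg]
  have : ((1 + x * x)⁻¹ + (1 + y * y)⁻¹ * (y + z) * (1 + z * z)⁻¹ * x) +
      ((1 + y * y)⁻¹ + (1 + z * z)⁻¹ * (z + x) * (1 + x * x)⁻¹ * y) +
      ((1 + z * z)⁻¹ + (1 + x * x)⁻¹ * (x + y) * (1 + y * y)⁻¹ * z) - 1 / 4 =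
      ((1 + x * y) * (1 + x * y + x * x + y * y) + (1 + y * z) * (1 + y * z + y * y + z * z) +
        (1 + z * x) * (1 + z * x + z * z + x * x) -
        (1 + x * x) * (1 + y * y) * (1 + z * z) / 4) /
      ((1 + x * x) * (1 + y * y) * (1 + z * z)) := by
    field_simp
    ring
  rw [this]
  apply div_nonneg _ (by positivity)
  nlinarith

theorem sum_weight_ge {μ : Fin n → ℝ} (hμ : ∀ i, μ i * μ i ≤ 1) {w : Fin n → Fin n → Fin n → ℝ}
    (h0 : ∀ k i j, 0 ≤ w k i j) (h1 : ∀ k i j, w k i j = w k j i)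
    (h2 : ∀ k i j, w k i j = w i k j) :
    1 / 12 * ∑ k, ∑ i, ∑ j, w k i j ≤
      ∑ k, ∑ i, ∑ j, ((1 + μ k * μ k)⁻¹ +
        (1 + μ i * μ i)⁻¹ * (μ i + μ j) * (1 + μ j * μ j)⁻¹ * μ k) * w k i j := by
  set f : Fin n → Fin n → Fin n → ℝ := fun k i j => (1 + μ k * μ k)⁻¹ +
        (1 + μ i * μ i)⁻¹ * (μ i + μ j) * (1 + μ j * μ j)⁻¹ * μ k with hf
  have cyc (f : Fin n → Fin n → Fin n → ℝ) :
      ∑ k, ∑ i, ∑ j, f k i j * w k i j = ∑ k, ∑ i, ∑ j, f i j k * w k i j := by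
    calc ∑ k, ∑ i, ∑ j, f k i j * w k i j = ∑ k, ∑ i, ∑ j, f k i j * w j k i := by
          refine Finset.sum_congr rfl fun k _ => Finset.sum_congr rfl fun i _ =>
            Finset.sum_congr rfl fun j _ => ?_
          rw [h1 k i j, h2 k j i]
      _ = ∑ k, ∑ j, ∑ i, f k i j * w j k i :=
          Finset.sum_congr rfl fun k _ => Finset.sum_comm
      _ = _ := Finset.sum_comm
  have e1 := cyc f
  have e2 := cyc fun k i j => f i j k
  have : 1 / 4 * ∑ k, ∑ i, ∑ j, w k i j ≤
      ∑ k, ∑ i, ∑ j, f k i j * w k i j + ∑ k, ∑ i, ∑ j, f i j k * w k i j +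
      ∑ k, ∑ i, ∑ j, f j k i * w k i j := by
    simp only [Finset.mul_sum, ← Finset.sum_add_distrib]
    refine Finset.sum_le_sum fun k _ => Finset.sum_le_sum fun i _ =>
      Finset.sum_le_sum fun j _ => ?_
    rw [← add_mul, ← add_mul]
    exact mul_le_mul_of_nonneg_right (weight_ge (hμ k) (hμ i) (hμ j)) (h0 k i j)
  have e3 : ∑ k, ∑ i, ∑ j, f j k i * w k i j = ∑ k, ∑ i, ∑ j, f k i j * w k i j := by
    rw [e1, e2]
  linarith

theorem sum_mul_bilin {V : Type*} [AddCommGroup V] [Module ℝ V] (B : V →ₗ[ℝ] V →ₗ[ℝ] ℝ)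
    (T : Fin n → V) (U : Matrix (Fin n) (Fin n) ℝ) (d : Fin n → ℝ) :
    ∑ a, ∑ b, (U * diagonal d * Uᵀ) a b * B (T b) (T a) =
      ∑ c, d c * B (∑ k, U k c • T k) (∑ k, U k c • T k) := by
  have h (a b : Fin n) : (U * diagonal d * Uᵀ) a b = ∑ c, U a c * d c * U b c := by
    rw [mul_apply]
    simp only [mul_diagonal, transpose_apply]
  simp only [map_sum, map_smul, LinearMap.sum_apply, LinearMap.smul_apply, h,
    Finset.sum_mul, smul_eq_mul, Finset.mul_sum]
  rw [Finset.sum_congr rfl fun a _ => Finset.sum_comm, Finset.sum_comm]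
  refine Finset.sum_congr rfl fun c _ => Finset.sum_congr rfl fun a _ =>
    Finset.sum_congr rfl fun b _ => ?_
  ring

theorem trace_weighted (g μ : Fin n → ℝ) (S : Matrix (Fin n) (Fin n) ℝ)
    (hS : ∀ i j, S i j = S j i) :
    trace (diagonal g * (diagonal μ * S + S * diagonal μ) * diagonal g * S) =
      ∑ i, ∑ j, g i * (μ i + μ j) * g j * (S i j * S i j) := by
  simp only [trace, diag]
  refine Finset.sum_congr rfl fun i _ => ?_
  rw [mul_apply]
  refine Finset.sum_congr rfl fun j _ => ?_
  rw [mul_diagonal, diagonal_mul, Matrix.add_apply, mul_diagonal, diagonal_mul, hS j i]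
  ring

/-- The spectral theorem for real symmetric matrices. -/
theorem exists_orthogonal_diagonal {H : Matrix (Fin n) (Fin n) ℝ} (hH : Hᵀ = H) :
    ∃ (U : Matrix (Fin n) (Fin n) ℝ) (μ : Fin n → ℝ),
      Uᵀ * U = 1 ∧ U * Uᵀ = 1 ∧ H = U * diagonal μ * Uᵀ := by
  have hHerm : H.IsHermitian := by
    rw [IsHermitian, conjTranspose_eq_transpose_of_trivial, hH]
  have hUs : star (hHerm.eigenvectorUnitary : Matrix (Fin n) (Fin n) ℝ) =
      (hHerm.eigenvectorUnitary : Matrix (Fin n) (Fin n) ℝ)ᵀ := by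
    rw [star_eq_conjTranspose, conjTranspose_eq_transpose_of_trivial]
  refine ⟨hHerm.eigenvectorUnitary, hHerm.eigenvalues, ?_, ?_, ?_⟩
  · rw [← hUs]; exact (Unitary.mem_iff.1 hHerm.eigenvectorUnitary.2).1
  · rw [← hUs]; exact (Unitary.mem_iff.1 hHerm.eigenvectorUnitary.2).2
  · have := hHerm.spectral_theorem
    rw [Unitary.conjStarAlgAut_apply] at this
    rw [← hUs]
    exact this

theorem coercive_algebra {H : Matrix (Fin n) (Fin n) ℝ} (hH : Hᵀ = H)
    (hb : (1 - H * H).PosSemidef) {T : Fin n → Matrix (Fin n) (Fin n) ℝ}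
    (h1 : ∀ k i j, T k i j = T k j i) (h2 : ∀ k i j, T k i j = T i k j) :
    1 / 12 * ∑ k, ∑ i, ∑ j, T k i j * T k i j ≤
      ∑ a, ∑ b, H a b * trace ((1 + H * H)⁻¹ * (H * T b + T b * H) * (1 + H * H)⁻¹ * T a) +
      ∑ a, ∑ b, (1 + H * H)⁻¹ a b * trace (T b * T a) := by
  obtain ⟨U, μ, hUU, hUU', hsp⟩ := exists_orthogonal_diagonal hH
  have cancel (A B : Matrix (Fin n) (Fin n) ℝ) : U * A * Uᵀ * (U * B * Uᵀ) = U * (A * B) * Uᵀ := by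
    rw [mul_assoc, ← mul_assoc Uᵀ, ← mul_assoc Uᵀ, hUU, one_mul]
    simp only [mul_assoc]
  have hHH : H * H = U * diagonal (fun i => μ i * μ i) * Uᵀ := by
    conv_lhs => rw [hsp]
    rw [cancel, diagonal_mul_diagonal]
  have hone : (1 : Matrix (Fin n) (Fin n) ℝ) = U * diagonal (fun _ => 1) * Uᵀ := by
    rw [diagonal_one, mul_one, hUU']
  have hμ1 (i : Fin n) : μ i * μ i ≤ 1 := by
    have e : Uᵀ * (1 - H * H) * U = diagonal (fun i => 1 - μ i * μ i) := by
      have : 1 - H * H = U * diagonal (fun i => 1 - μ i * μ i) * Uᵀ := by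
        rw [hHH]; nth_rewrite 1 [hone]
        rw [← sub_mul, ← mul_sub, diagonal_sub]
      rw [this, mul_assoc, mul_assoc, hUU, mul_one, ← mul_assoc, hUU, one_mul]
    have h := hb.conjTranspose_mul_mul_same U
    rw [conjTranspose_eq_transpose_of_trivial, e, posSemidef_diagonal_iff] at h
    linarith [h i]
  set g : Fin n → ℝ := fun i => (1 + μ i * μ i)⁻¹ with hg
  have hG : (1 + H * H)⁻¹ = U * diagonal g * Uᵀ := by
    apply inv_eq_left_inv
    have : 1 + H * H = U * diagonal (fun i => 1 + μ i * μ i) * Uᵀ := by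
      rw [hHH]; nth_rewrite 1 [hone]
      rw [← add_mul, ← mul_add, diagonal_add]
    rw [this, cancel, diagonal_mul_diagonal]
    have : (fun i => g i * (1 + μ i * μ i)) = fun _ => 1 :=
      funext fun i => inv_mul_cancel₀ (by nlinarith [mul_self_nonneg (μ i)])
    rw [this, ← hone]
  set S : Fin n → Matrix (Fin n) (Fin n) ℝ := fun c => Uᵀ * (∑ k, U k c • T k) * U with hS
  have hST (c : Fin n) : ∑ k, U k c • T k = U * S c * Uᵀ := by
    simp only [hS]
    rw [← mul_assoc, ← mul_assoc, hUU', one_mul, mul_assoc, hUU', mul_one]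
  have hSe (c i j : Fin n) : S c i j = ∑ k, ∑ b, ∑ a, U k c * U a i * U b j * T k a b := by
    simp only [hS, mul_apply, Matrix.sum_apply, Matrix.smul_apply, transpose_apply, smul_eq_mul,
      Finset.sum_mul, Finset.mul_sum]
    refine Finset.sum_congr rfl fun c _ => Finset.sum_congr rfl fun a _ =>
      Finset.sum_congr rfl fun b _ => ?_
    ring
  have s1 (c i j : Fin n) : S c i j = S c j i := by
    rw [hSe, hSe]
    refine Finset.sum_congr rfl fun k _ => ?_
    rw [Finset.sum_comm]
    refine Finset.sum_congr rfl fun a _ => Finset.sum_congr rfl fun b _ => ?_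
    rw [h1 k a b]; ring
  have s2 (c i j : Fin n) : S c i j = S i c j := by
    rw [hSe, hSe, Finset.sum_comm]
    conv_rhs => rw [Finset.sum_comm]
    refine Finset.sum_congr rfl fun b _ => ?_
    rw [Finset.sum_comm]
    refine Finset.sum_congr rfl fun a _ => Finset.sum_congr rfl fun k _ => ?_
    rw [h2 k a b]; ring
  have tr (A : Matrix (Fin n) (Fin n) ℝ) : trace (U * A * Uᵀ) = trace A := by
    rw [trace_mul_comm, ← mul_assoc, hUU, one_mul]
  let B1 : Matrix (Fin n) (Fin n) ℝ →ₗ[ℝ] Matrix (Fin n) (Fin n) ℝ →ₗ[ℝ] ℝ :=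
    LinearMap.mk₂ ℝ (fun A B => trace (A * B)) (by simp [add_mul]) (by simp) (by simp [mul_add])
      (by simp)
  have t1 (d : Fin n → ℝ) : ∑ a, ∑ b, (U * diagonal d * Uᵀ) a b * trace (T b * T a) =
      ∑ c, d c * ∑ i, ∑ j, S c i j * S c i j := by
    refine (sum_mul_bilin B1 T U d).trans ?_
    refine Finset.sum_congr rfl fun c _ => ?_
    rw [hST]
    simp only [B1, LinearMap.mk₂_apply]
    rw [cancel, tr]
    simp only [trace, diag, mul_apply]
    congr 1
    refine Finset.sum_congr rfl fun i _ => Finset.sum_congr rfl fun j _ => ?_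
    rw [s1 c j i]
  let B2 : Matrix (Fin n) (Fin n) ℝ →ₗ[ℝ] Matrix (Fin n) (Fin n) ℝ →ₗ[ℝ] ℝ :=
    LinearMap.mk₂ ℝ (fun A B => trace ((1 + H * H)⁻¹ * (H * A + A * H) * (1 + H * H)⁻¹ * B))
      (fun A A' B => by rw [← trace_add]; congr 1; noncomm_ring)
      (fun c A B => by simp [← smul_add]) (fun A B B' => by rw [← trace_add]; congr 1; noncomm_ring)
      (by simp)
  have t2 : ∑ a, ∑ b, H a b * trace ((1 + H * H)⁻¹ * (H * T b + T b * H) * (1 + H * H)⁻¹ * T a) =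
      ∑ c, μ c * ∑ i, ∑ j, g i * (μ i + μ j) * g j * (S c i j * S c i j) := by
    have := sum_mul_bilin B2 T U μ
    rw [← hsp] at this
    refine this.trans (Finset.sum_congr rfl fun c _ => ?_)
    rw [hST]
    simp only [B2, LinearMap.mk₂_apply]
    rw [← trace_weighted g μ (S c) (s1 c), hG]
    nth_rewrite 1 2 [hsp]
    rw [cancel, cancel, ← add_mul, ← mul_add, cancel, cancel, cancel, tr]
  have t3 := t1 fun _ => 1
  rw [← hone] at t3
  have t4 : ∑ k, ∑ i, ∑ j, T k i j * T k i j = ∑ k, ∑ i, ∑ j, S k i j * S k i j := by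
    simp only [one_mul] at t3
    rw [← t3]
    simp only [Matrix.one_apply, ite_mul, one_mul, zero_mul, Finset.sum_ite_eq, Finset.mem_univ,
      if_true, trace, diag, mul_apply]
    refine Finset.sum_congr rfl fun k _ => Finset.sum_congr rfl fun i _ =>
      Finset.sum_congr rfl fun j _ => ?_
    rw [h1 k j i]
  rw [t2, hG, t1, t4]
  refine (sum_weight_ge hμ1 (w := fun k i j => S k i j * S k i j)
    (fun k i j => mul_self_nonneg _) (fun k i j => by simp only [s1 k i j])
    (fun k i j => by simp only [s2 k i j])).trans_eq ?_
  simp only [Finset.mul_sum, ← Finset.sum_add_distrib]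
  refine Finset.sum_congr rfl fun k _ => Finset.sum_congr rfl fun i _ =>
    Finset.sum_congr rfl fun j _ => ?_
  simp only [hg]
  ring

/-- The squared Frobenius norm of the Jacobian. -/
noncomputable def jacSq (q : (Fin n → ℝ) → (Fin n → ℝ)) (x : Fin n → ℝ) : ℝ :=
  ∑ a, ∑ b, jac q x a b * jac q x a b

/-- The squared norm of the derivative of the Jacobian. -/
noncomputable def hessSq (q : (Fin n → ℝ) → (Fin n → ℝ)) (x : Fin n → ℝ) : ℝ :=
  ∑ k, ∑ i, ∑ j, pd k (jac q) x i j * pd k (jac q) x i j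

namespace IsSLGraph

variable {q : (Fin n → ℝ) → (Fin n → ℝ)}

theorem contDiff_jacSq (hq : IsSLGraph q) : ContDiff ℝ ∞ (jacSq q) :=
  ContDiff.sum fun a _ => ContDiff.sum fun b _ =>
    (hq.contDiff_jac_apply a b).mul (hq.contDiff_jac_apply a b)

theorem lap_jacSq_ge (hq : IsSLGraph q) (x : Fin n → ℝ) :
    1 / 6 * hessSq q x ≤ lap q (jacSq q) x := by
  have hc (a b : Fin n) : ContDiff ℝ ∞ fun y => jac q y a b * jac q y a b :=
    (hq.contDiff_jac_apply a b).mul (hq.contDiff_jac_apply a b)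
  have e : lap q (jacSq q) x =
      2 * (∑ a, ∑ b, jac q x a b * trace (ginv q x * (jac q x * pd b (jac q) x +
        pd b (jac q) x * jac q x) * ginv q x * pd a (jac q) x) +
      ∑ a, ∑ b, ginv q x a b * trace (pd b (jac q) x * pd a (jac q) x)) := by
    unfold jacSq
    rw [lap_sum fun a _ => ContDiff.sum fun b _ => hc a b]
    have h1 (a : Fin n) : lap q (fun y => ∑ b, jac q y a b * jac q y a b) x =
      ∑ b, lap q (fun y => jac q y a b * jac q y a b) x := lap_sum (fun b _ => hc a b) x
    simp_rw [h1]
    have h2 (a b : Fin n) := lap_mul_self (q := q) (hq.contDiff_jac_apply a b) x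
    simp_rw [h2, hq.lap_jac, Finset.sum_add_distrib]
    rw [mul_add]
    have h4 (c t : ℝ) : 2 * c * t = 2 * (c * t) := mul_assoc _ _ _
    simp_rw [h4, ← Finset.mul_sum]
    congr 2
    have h3 (k a b : Fin n) : pd k (fun y => jac q y a b) x = pd k (jac q) x a b :=
      pd_entry (hq.differentiable_jac x) k a b
    simp_rw [h3, trace, diag, mul_apply, Finset.mul_sum]
    calc _ = ∑ a, ∑ i, ∑ b, ∑ j, ginv q x i j *
          (pd i (jac q) x a b * pd j (jac q) x a b) :=
            Finset.sum_congr rfl fun a _ => Finset.sum_comm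
      _ = ∑ i, ∑ a, ∑ j, ∑ b, ginv q x i j * (pd i (jac q) x a b * pd j (jac q) x a b) := by
          rw [Finset.sum_comm]
          exact Finset.sum_congr rfl fun i _ => Finset.sum_congr rfl fun a _ => Finset.sum_comm
      _ = ∑ i, ∑ j, ∑ a, ∑ b, ginv q x i j * (pd i (jac q) x a b * pd j (jac q) x a b) :=
          Finset.sum_congr rfl fun a _ => Finset.sum_comm
      _ = _ := by
          refine Finset.sum_congr rfl fun i _ => Finset.sum_congr rfl fun j _ =>
            Finset.sum_congr rfl fun a _ => Finset.sum_congr rfl fun b _ => ?_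
          rw [hq.pd_jac_symm x i a b, mul_comm (pd i (jac q) x b a)]
  have := coercive_algebra (hq.symm x) (hq.bdd x) (hq.pd_jac_symm x) (hq.pd_jac_comm x)
  rw [e, hessSq]
  simp only [ginv]
  linarith

end IsSLGraph

end SpecialLagrangian

namespace SpecialLagrangian

open scoped ContDiff Matrix.Norms.Operator

variable {n : ℕ}

/-- The truncated power `x ↦ max(x, 0) ^ k`. -/
noncomputable def posPow (k : ℕ) (x : ℝ) : ℝ := max x 0 ^ k

theorem posPow_nonneg (k : ℕ) (x : ℝ) : 0 ≤ posPow k x := pow_nonneg (le_max_right _ _) _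

theorem continuous_posPow (k : ℕ) : Continuous (posPow k) := by
  unfold posPow; fun_prop

theorem posPow_of_nonpos {k : ℕ} (hk : k ≠ 0) {x : ℝ} (hx : x ≤ 0) : posPow k x = 0 := by
  rw [posPow, max_eq_right hx, zero_pow hk]

theorem posPow_of_nonneg (k : ℕ) {x : ℝ} (hx : 0 ≤ x) : posPow k x = x ^ k := by
  rw [posPow, max_eq_left hx]

theorem posPow_one_mul_self (x : ℝ) : posPow 1 x * x = posPow 2 x := by
  rcases le_total x 0 with h | h
  · simp [posPow_of_nonpos, h]
  · simp only [posPow_of_nonneg _ h]; ring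

theorem posPow_mono (k : ℕ) {x y : ℝ} (h : x ≤ y) : posPow k x ≤ posPow k y :=
  pow_le_pow_left₀ (le_max_right _ _) (max_le_max_right _ h) _

theorem hasDerivAt_posPow (k : ℕ) (x : ℝ) :
    HasDerivAt (posPow (k + 2)) ((k + 2) * posPow (k + 1) x) x := by
  have hpow : HasDerivAt (fun y : ℝ => y ^ (k + 2)) ((k + 2) * x ^ (k + 1)) x := by
    simpa using hasDerivAt_pow (k + 2) x
  rcases lt_trichotomy x 0 with h | h | h
  · rw [posPow_of_nonpos (by simp) h.le, mul_zero]
    refine (hasDerivAt_const x (0 : ℝ)).congr_of_eventuallyEq ?_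
    filter_upwards [Iio_mem_nhds h] with y hy
    exact posPow_of_nonpos (by simp) (le_of_lt hy)
  · subst h
    rw [posPow_of_nonpos (by simp) le_rfl, mul_zero, hasDerivAt_iff_isLittleO]
    have h0 : (fun y : ℝ => y ^ (k + 2)) =o[nhds 0] fun y => y := by
      simpa using hasDerivAt_iff_isLittleO.1 hpow
    simp only [posPow_of_nonpos (k := k + 2) (by simp) (le_refl (0 : ℝ)), sub_zero, smul_zero]
    refine Asymptotics.IsBigO.trans_isLittleO ?_ h0
    refine Asymptotics.IsBigO.of_bound 1 (Filter.Eventually.of_forall fun y => ?_)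
    rw [one_mul, posPow, norm_pow, norm_pow]
    refine pow_le_pow_left₀ (norm_nonneg _) ?_ _
    rw [Real.norm_eq_abs, Real.norm_eq_abs, abs_of_nonneg (le_max_right _ _)]
    exact max_le (le_abs_self _) (abs_nonneg _)
  · rw [posPow_of_nonneg _ h.le]
    refine hpow.congr_of_eventuallyEq ?_
    filter_upwards [Ioi_mem_nhds h] with y hy
    exact posPow_of_nonneg _ (le_of_lt hy)

theorem deriv_posPow (k : ℕ) : deriv (posPow (k + 2)) = fun x => (k + 2) * posPow (k + 1) x :=
  funext fun x => (hasDerivAt_posPow k x).deriv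

theorem contDiff_posPow_two : ContDiff ℝ 1 (posPow 2) := by
  rw [contDiff_one_iff_deriv, deriv_posPow 0]
  exact ⟨fun x => (hasDerivAt_posPow 0 x).differentiableAt, (continuous_posPow 1).const_mul _⟩

theorem contDiff_posPow_three : ContDiff ℝ 1 (posPow 3) := by
  rw [contDiff_one_iff_deriv, deriv_posPow 1]
  exact ⟨fun x => (hasDerivAt_posPow 1 x).differentiableAt, (continuous_posPow 2).const_mul _⟩

theorem pd_comp {h : ℝ → ℝ} {h' : ℝ} {s : (Fin n → ℝ) → ℝ} {x : Fin n → ℝ}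
    (hh : HasDerivAt h h' (s x)) (hs : DifferentiableAt ℝ s x) (k : Fin n) :
    pd k (fun y => h (s y)) x = h' * pd k s x := by
  have : HasFDerivAt (fun y => h (s y)) _ x := hh.comp_hasFDerivAt x hs.hasFDerivAt
  rw [pd, this.fderiv]
  rfl

theorem HasCompactSupport.pd {f : (Fin n → ℝ) → ℝ} (hf : HasCompactSupport f) (k : Fin n) :
    HasCompactSupport (pd k f) := by
  exact (HasCompactSupport.fderiv ℝ hf).comp_left
    (g := fun L : (Fin n → ℝ) →L[ℝ] ℝ => L (Pi.single k 1)) rfl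

theorem continuous_pd {f : (Fin n → ℝ) → ℝ} (hf : ContDiff ℝ 1 f) (k : Fin n) :
    Continuous (pd k f) :=
  (hf.continuous_fderiv (by simp)).clm_apply continuous_const

open MeasureTheory

theorem integral_pd {f : (Fin n → ℝ) → ℝ} (hf : ContDiff ℝ 1 f) (hc : HasCompactSupport f)
    (k : Fin n) : ∫ x, pd k f x = 0 := by
  have hi : Integrable (pd k f) :=
    (continuous_pd hf k).integrable_of_hasCompactSupport (HasCompactSupport.pd hc k)
  have hi0 : Integrable f := hf.continuous.integrable_of_hasCompactSupport hc
  have := integral_mul_fderiv_eq_neg_fderiv_mul_of_integrable (μ := (volume : Measure (Fin n → ℝ)))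
    (f := fun _ => (1 : ℝ)) (g := f) (v := Pi.single k 1) (by simp) (by simpa using! hi)
    (by simpa using hi0) (fun _ _ => differentiableAt_const _)
    (fun x _ => hf.differentiable (by simp) x)
  simpa using! this

namespace IsSLGraph

variable {q : (Fin n → ℝ) → (Fin n → ℝ)}

theorem contDiff_weight (hq : IsSLGraph q) (i j : Fin n) :
    ContDiff ℝ 1 (fun y => vol q y * ginv q y i j) :=
  (hq.contDiff_vol.mul (hq.contDiff_ginv_apply i j)).of_le (by simp)

theorem sum_pd_flux (hq : IsSLGraph q) {f g : (Fin n → ℝ) → ℝ} (hf : ContDiff ℝ 1 f)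
    (hg : ∀ j, ContDiff ℝ 1 (pd j g)) (x : Fin n → ℝ) :
    ∑ i, pd i (fun y => ∑ j, (vol q y * ginv q y i j) * (f y * pd j g y)) x =
      vol q x * (f x * lap q g x + ∑ i, ∑ j, ginv q x i j * (pd i f x * pd j g x)) := by
  have hd (j : Fin n) : DifferentiableAt ℝ (fun y => f y * pd j g y) x :=
    (hf.mul (hg j)).differentiable (by simp) x
  have hw (i j : Fin n) : DifferentiableAt ℝ (fun y => vol q y * ginv q y i j) x :=
    (hq.contDiff_weight i j).differentiable (by simp) x
  have h1 (i : Fin n) : pd i (fun y => ∑ j, (vol q y * ginv q y i j) * (f y * pd j g y)) x =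
      ∑ j, (vol q x * ginv q x i j * (f x * pd i (pd j g) x + pd i f x * pd j g x) +
        pd i (fun y => vol q y * ginv q y i j) x * (f x * pd j g x)) := by
    rw [pd_sum (f := fun j y => (vol q y * ginv q y i j) * (f y * pd j g y))
      fun j _ => (hw i j).mul (hd j)]
    refine Finset.sum_congr rfl fun j _ => ?_
    rw [pd_mul (f := fun y => vol q y * ginv q y i j) (g := fun y => f y * pd j g y)
        (hw i j) (hd j),
      pd_mul (hf.differentiable (by simp) x) ((hg j).differentiable (by simp) x)]
  simp_rw [h1, Finset.sum_add_distrib]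
  have h2 : ∑ i, ∑ j, pd i (fun y => vol q y * ginv q y i j) x * (f x * pd j g x) = 0 := by
    rw [Finset.sum_comm]
    simp_rw [← Finset.sum_mul, hq.sum_pd_vol_mul_ginv]
    simp
  rw [h2, add_zero, lap]
  simp only [mul_add, Finset.sum_add_distrib, Finset.mul_sum]
  congr 1
  · refine Finset.sum_congr rfl fun i _ => Finset.sum_congr rfl fun j _ => by ring
  · refine Finset.sum_congr rfl fun i _ => Finset.sum_congr rfl fun j _ => by ring

/-- **Green's identity** on a special Lagrangian graph. -/
theorem integral_mul_lap (hq : IsSLGraph q) {f g : (Fin n → ℝ) → ℝ} (hf : ContDiff ℝ 1 f)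
    (hf' : ∀ j, ContDiff ℝ 1 (pd j f)) (hc : HasCompactSupport f) (hg : ContDiff ℝ 1 g)
    (hg' : ∀ j, ContDiff ℝ 1 (pd j g)) :
    ∫ x, vol q x * (f x * lap q g x - g x * lap q f x) = 0 := by
  have c1 (i : Fin n) : ContDiff ℝ 1 fun y => ∑ j, (vol q y * ginv q y i j) * (f y * pd j g y) :=
    ContDiff.sum fun j _ => (hq.contDiff_weight i j).mul (hf.mul (hg' j))
  have c2 (i : Fin n) : ContDiff ℝ 1 fun y => ∑ j, (vol q y * ginv q y i j) * (g y * pd j f y) :=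
    ContDiff.sum fun j _ => (hq.contDiff_weight i j).mul (hg.mul (hf' j))
  have s1 (i : Fin n) : HasCompactSupport
      fun y => ∑ j, (vol q y * ginv q y i j) * (f y * pd j g y) := by
    refine hc.mono fun y hy => ?_
    contrapose! hy
    simp [Function.notMem_support.1 hy]
  have s2 (i : Fin n) : HasCompactSupport
      fun y => ∑ j, (vol q y * ginv q y i j) * (g y * pd j f y) := by
    refine HasCompactSupport.intro (K := tsupport f) hc fun y hy => ?_
    have : ∀ j, pd j f y = 0 := fun j => by
      rw [pd, image_eq_zero_of_notMem_tsupport fun h => hy (tsupport_fderiv_subset ℝ h)]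
      rfl
    simp [this]
  have key (x : Fin n → ℝ) : vol q x * (f x * lap q g x - g x * lap q f x) =
      ∑ i, (pd i (fun y => ∑ j, (vol q y * ginv q y i j) * (f y * pd j g y)) x -
        pd i (fun y => ∑ j, (vol q y * ginv q y i j) * (g y * pd j f y)) x) := by
    rw [Finset.sum_sub_distrib, hq.sum_pd_flux hf hg', hq.sum_pd_flux hg hf']
    have : ∑ i, ∑ j, ginv q x i j * (pd i f x * pd j g x) =
        ∑ i, ∑ j, ginv q x i j * (pd i g x * pd j f x) := by
      rw [Finset.sum_comm]
      refine Finset.sum_congr rfl fun i _ => Finset.sum_congr rfl fun j _ => ?_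
      have := congrFun (congrFun (hq.ginv_symm x) i) j
      rw [transpose_apply] at this
      rw [this]; ring
    rw [this]; ring
  have i1 (i : Fin n) := ((continuous_pd (c1 i) i).integrable_of_hasCompactSupport
    (μ := volume) (HasCompactSupport.pd (s1 i) i))
  have i2 (i : Fin n) := ((continuous_pd (c2 i) i).integrable_of_hasCompactSupport
    (μ := volume) (HasCompactSupport.pd (s2 i) i))
  simp_rw [key]
  refine (integral_finsetSum _ fun i _ => (i1 i).sub (i2 i)).trans ?_
  refine Finset.sum_eq_zero fun i _ => ?_
  refine (integral_sub (i1 i) (i2 i)).trans ?_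
  rw [integral_pd (c1 i) (s1 i), integral_pd (c2 i) (s2 i), sub_zero]

end IsSLGraph

/-- The squared length of the normal component of the position vector of the graph of `q`. -/
noncomputable def normalSq (q : (Fin n → ℝ) → (Fin n → ℝ)) (x : Fin n → ℝ) : ℝ :=
  (q x - jac q x *ᵥ x) ⬝ᵥ (ginv q x *ᵥ (q x - jac q x *ᵥ x))

namespace IsSLGraph

variable {q : (Fin n → ℝ) → (Fin n → ℝ)}

theorem pd_distSq (hq : IsSLGraph q) (k : Fin n) (x : Fin n → ℝ) :
    pd k (distSq q) x = 2 * (x + jac q x *ᵥ q x) k := by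
  unfold distSq
  rw [pd_sum fun i _ => (((contDiff_coord i).mul (contDiff_coord i)).add
    ((hq.smooth_apply i).mul (hq.smooth_apply i))).differentiable (by simp) x]
  have h (i : Fin n) : pd k (fun y => y i * y i + q y i * q y i) x =
      2 * (x i * (if k = i then 1 else 0) + jac q x k i * q x i) := by
    have d1 := (contDiff_coord i).differentiable (by simp) x
    have d2 := (hq.smooth_apply i).differentiable (by simp) x
    have : pd k (fun y => y i * y i + q y i * q y i) x =
        pd k (fun y => y i * y i) x + pd k (fun y => q y i * q y i) x := by
      unfold pd
      rw [fderiv_fun_add (f := fun y => y i * y i) (g := fun y => q y i * q y i)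
        (d1.mul d1) (d2.mul d2)]
      rfl
    rw [this, pd_mul d1 d1, pd_mul d2 d2, pd_apply_self]
    simp only [jac, of_apply]
    ring
  simp_rw [h]
  rw [← Finset.mul_sum, Finset.sum_add_distrib]
  simp [mulVec, dotProduct]

theorem sum_ginv_pd_distSq (hq : IsSLGraph q) (x : Fin n → ℝ) :
    ∑ i, ∑ j, ginv q x i j * (pd i (distSq q) x * pd j (distSq q) x) =
      4 * (distSq q x - normalSq q x) := by
  set H := jac q x with hH
  set G := ginv q x with hG
  have hu : G * (1 + H * H) = 1 :=
    nonsing_inv_mul _ ((isUnit_iff_isUnit_det _).1 (isUnit_one_add_mul_self (hq.symm x)))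
  have e1 : ∑ i, ∑ j, G i j * (pd i (distSq q) x * pd j (distSq q) x) =
      4 * ((x + H *ᵥ q x) ⬝ᵥ (G *ᵥ (x + H *ᵥ q x))) := by
    simp only [hq.pd_distSq, mulVec, dotProduct, Finset.mul_sum]
    refine Finset.sum_congr rfl fun i _ => Finset.sum_congr rfl fun j _ => ?_
    ring
  have e2 : distSq q x = x ⬝ᵥ ((G * (1 + H * H)) *ᵥ x) + q x ⬝ᵥ ((G * (1 + H * H)) *ᵥ q x) := by
    rw [hu, one_mulVec, one_mulVec]
    simp [distSq, dotProduct, Finset.sum_add_distrib]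
  have comm : G * H = H * G := hq.ginv_mul_jac x
  have tr (u v : Fin n → ℝ) : (H *ᵥ u) ⬝ᵥ v = u ⬝ᵥ (H *ᵥ v) := by
    rw [dotProduct_mulVec, ← mulVec_transpose, hq.symm x]
  have trG (u v : Fin n → ℝ) : (G *ᵥ u) ⬝ᵥ v = u ⬝ᵥ (G *ᵥ v) := by
    rw [dotProduct_mulVec, ← mulVec_transpose, hq.ginv_symm x]
  have e3 : x ⬝ᵥ (G *ᵥ (H *ᵥ q x)) = q x ⬝ᵥ (G *ᵥ (H *ᵥ x)) := by
    rw [← trG, ← tr, dotProduct_comm, mulVec_mulVec, mulVec_mulVec, comm]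
  rw [e1, e2, normalSq, ← hH, ← hG]
  congr 1
  simp only [mulVec_add, add_dotProduct, dotProduct_add, mulVec_sub, sub_dotProduct,
    dotProduct_sub, tr, mul_add, mul_one, add_mulVec]
  have e4 (u v : Fin n → ℝ) : u ⬝ᵥ (H *ᵥ (G *ᵥ v)) = u ⬝ᵥ (G *ᵥ (H *ᵥ v)) := by
    rw [mulVec_mulVec, mulVec_mulVec, comm]
  simp only [e4, ← mulVec_mulVec, e3]
  ring

/-- The Laplacian of the cutoff function of the monotonicity formula. -/
theorem lap_posPow (hq : IsSLGraph q) (t : ℝ) (x : Fin n → ℝ) :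
    lap q (fun y => posPow 3 (t - distSq q y)) x =
      24 * t * posPow 1 (t - distSq q x) - (24 + 6 * n) * posPow 2 (t - distSq q x)
        - 24 * (posPow 1 (t - distSq q x) * normalSq q x) := by
  have hs : Differentiable ℝ (distSq q) := hq.contDiff_distSq.differentiable (by simp)
  have h1 (j : Fin n) : pd j (fun y => posPow 3 (t - distSq q y)) =
      fun y => -3 * posPow 2 (t - distSq q y) * pd j (distSq q) y := by
    funext y
    have h := (hasDerivAt_posPow 1 (t - distSq q y)).comp (distSq q y)
      ((hasDerivAt_id (distSq q y)).const_sub t)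
    rw [pd_comp (h := fun σ => posPow 3 (t - σ)) h (hs y)]
    push_cast
    ring_nf
  have h2 (i j : Fin n) : pd i (fun y => -3 * posPow 2 (t - distSq q y) * pd j (distSq q) y) x =
      6 * posPow 1 (t - distSq q x) * (pd i (distSq q) x * pd j (distSq q) x) -
      3 * posPow 2 (t - distSq q x) * pd i (pd j (distSq q)) x := by
    have h := ((hasDerivAt_posPow 0 (t - distSq q x)).comp (distSq q x)
      ((hasDerivAt_id (distSq q x)).const_sub t)).const_mul (-3)
    have hd : DifferentiableAt ℝ (fun y => -3 * posPow 2 (t - distSq q y)) x :=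
      (h.comp_hasFDerivAt x (hs x).hasFDerivAt).differentiableAt
    rw [pd_mul hd ((contDiff_pd hq.contDiff_distSq j).differentiable (by simp) x),
      pd_comp (h := fun σ => -3 * posPow 2 (t - σ)) h (hs x)]
    push_cast
    ring_nf
  have h3 : lap q (fun y => posPow 3 (t - distSq q y)) x =
      6 * posPow 1 (t - distSq q x) *
        (∑ i, ∑ j, ginv q x i j * (pd i (distSq q) x * pd j (distSq q) x)) -
      3 * posPow 2 (t - distSq q x) * lap q (distSq q) x := by
    simp only [lap, h1, h2, Finset.mul_sum, ← Finset.sum_sub_distrib]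
    refine Finset.sum_congr rfl fun i _ => Finset.sum_congr rfl fun j _ => ?_
    ring
  rw [h3, hq.sum_ginv_pd_distSq, hq.lap_distSq]
  have := posPow_one_mul_self (t - distSq q x)
  linear_combination -24 * this

end IsSLGraph

end SpecialLagrangian

namespace SpecialLagrangian

open scoped ContDiff Matrix.Norms.Operator
open MeasureTheory

variable {n : ℕ}

theorem exists_one_add_mul_self_eq {H : Matrix (Fin n) (Fin n) ℝ} (hH : Hᵀ = H) :
    ∃ (U : Matrix (Fin n) (Fin n) ℝ) (μ : Fin n → ℝ), U * Uᵀ = 1 ∧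
      1 + H * H = U * diagonal (fun i => 1 + μ i * μ i) * Uᵀ := by
  obtain ⟨U, μ, hUU, hUU', hsp⟩ := exists_orthogonal_diagonal hH
  refine ⟨U, μ, hUU', ?_⟩
  have e : H * H = U * diagonal (fun i => μ i * μ i) * Uᵀ := by
    rw [hsp, mul_assoc, ← mul_assoc Uᵀ, ← mul_assoc Uᵀ, hUU, one_mul, ← diagonal_mul_diagonal]
    simp only [mul_assoc]
  have e1 : (1 : Matrix (Fin n) (Fin n) ℝ) = U * diagonal (fun _ => 1) * Uᵀ := by
    rw [diagonal_one, mul_one, hUU']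
  rw [e]
  nth_rewrite 1 [e1]
  rw [← add_mul, ← mul_add, diagonal_add]

theorem one_le_det_one_add_mul_self {H : Matrix (Fin n) (Fin n) ℝ} (hH : Hᵀ = H) :
    1 ≤ (1 + H * H).det := by
  obtain ⟨U, μ, hUU', h1⟩ := exists_one_add_mul_self_eq hH
  have h2 : U.det * Uᵀ.det = 1 := by rw [← det_mul, hUU', det_one]
  rw [h1, det_mul, det_mul, det_diagonal, mul_right_comm, h2, one_mul]
  exact Finset.one_le_prod fun i _ => by nlinarith [mul_self_nonneg (μ i)]

/-- A bound for the volume density. -/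
noncomputable def volBound (n : ℕ) : ℝ := √(n.factorial • ((1 + n : ℝ) ^ n))

namespace IsSLGraph

variable {q : (Fin n → ℝ) → (Fin n → ℝ)}

theorem sum_sq_jac_le (hq : IsSLGraph q) (x : Fin n → ℝ) (a : Fin n) :
    ∑ b, jac q x a b * jac q x a b ≤ 1 := by
  have h := (hq.bdd x).diag_nonneg (i := a)
  rw [Matrix.sub_apply, one_apply_eq, mul_apply] at h
  have : ∑ b, jac q x a b * jac q x b a = ∑ b, jac q x a b * jac q x a b := by
    refine Finset.sum_congr rfl fun b _ => ?_
    rw [← transpose_apply (jac q x) a b, hq.symm]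
  linarith

theorem abs_jac_le (hq : IsSLGraph q) (x : Fin n → ℝ) (a b : Fin n) : |jac q x a b| ≤ 1 := by
  rw [abs_le_one_iff_mul_self_le_one]
  exact (Finset.single_le_sum (f := fun b => jac q x a b * jac q x a b)
    (fun b _ => mul_self_nonneg _) (Finset.mem_univ b)).trans (hq.sum_sq_jac_le x a)

theorem jacSq_nonneg (q : (Fin n → ℝ) → (Fin n → ℝ)) (x : Fin n → ℝ) : 0 ≤ jacSq q x :=
  Finset.sum_nonneg fun _ _ => Finset.sum_nonneg fun _ _ => mul_self_nonneg _

theorem hessSq_nonneg (q : (Fin n → ℝ) → (Fin n → ℝ)) (x : Fin n → ℝ) : 0 ≤ hessSq q x :=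
  Finset.sum_nonneg fun _ _ => Finset.sum_nonneg fun _ _ => Finset.sum_nonneg fun _ _ =>
    mul_self_nonneg _

theorem jacSq_le (hq : IsSLGraph q) (x : Fin n → ℝ) : jacSq q x ≤ n := by
  refine (Finset.sum_le_sum fun a _ => hq.sum_sq_jac_le x a).trans ?_
  simp

theorem one_le_vol (hq : IsSLGraph q) (x : Fin n → ℝ) : 1 ≤ vol q x :=
  Real.one_le_sqrt.2 (one_le_det_one_add_mul_self (hq.symm x))

theorem vol_le (hq : IsSLGraph q) (x : Fin n → ℝ) : vol q x ≤ volBound n := by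
  refine Real.sqrt_le_sqrt ((le_abs_self _).trans ?_)
  have hb : ∀ i j,
      (AbsoluteValue.abs : AbsoluteValue ℝ ℝ) ((1 + jac q x * jac q x) i j) ≤ 1 + n := by
    intro i j
    rw [AbsoluteValue.abs_apply, Matrix.add_apply]
    refine (abs_add_le _ _).trans (add_le_add ?_ ?_)
    · rw [one_apply]; split_ifs <;> simp
    · rw [mul_apply]
      refine (Finset.abs_sum_le_sum_abs _ _).trans ?_
      refine (Finset.sum_le_card_nsmul _ _ 1 fun k _ => ?_).trans (by simp)
      rw [abs_mul]
      exact mul_le_one₀ (hq.abs_jac_le x i k) (abs_nonneg _) (hq.abs_jac_le x k j)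
  simpa using det_le hb

theorem norm_sq_le_distSq (q : (Fin n → ℝ) → (Fin n → ℝ)) (x : Fin n → ℝ) :
    ‖x‖ ^ 2 ≤ distSq q x := by
  have h0 : 0 ≤ distSq q x := Finset.sum_nonneg fun k _ =>
    add_nonneg (mul_self_nonneg _) (mul_self_nonneg _)
  rw [← Real.le_sqrt (norm_nonneg _) h0, pi_norm_le_iff_of_nonneg (Real.sqrt_nonneg _)]
  intro k
  rw [Real.le_sqrt (norm_nonneg _) h0, Real.norm_eq_abs, sq_abs, sq]
  have := Finset.single_le_sum (f := fun k => x k * x k + q x k * q x k)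
    (fun b _ => add_nonneg (mul_self_nonneg _) (mul_self_nonneg _)) (Finset.mem_univ k)
  exact le_trans (le_add_of_nonneg_right (mul_self_nonneg _)) this

theorem posPow_sub_distSq_eq_zero (q : (Fin n → ℝ) → (Fin n → ℝ)) {k : ℕ} (hk : k ≠ 0) {r : ℝ}
    (hr : 0 ≤ r) {x : Fin n → ℝ} (hx : x ∉ Metric.closedBall 0 r) :
    posPow k (r ^ 2 - distSq q x) = 0 := by
  refine posPow_of_nonpos hk ?_
  rw [mem_closedBall_zero_iff, not_le] at hx
  nlinarith [norm_sq_le_distSq q x]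

theorem hasCompactSupport_posPow (q : (Fin n → ℝ) → (Fin n → ℝ)) {k : ℕ} (hk : k ≠ 0) (t : ℝ) :
    HasCompactSupport fun x => posPow k (t - distSq q x) := by
  refine HasCompactSupport.intro (isCompact_closedBall (0 : Fin n → ℝ) (|t| + 1)) fun x hx => ?_
  refine posPow_of_nonpos hk ?_
  rw [mem_closedBall_zero_iff, not_le] at hx
  nlinarith [norm_sq_le_distSq q x, abs_nonneg t, le_abs_self t]

theorem continuous_posPow_sub_distSq (hq : IsSLGraph q) (k : ℕ) (t : ℝ) :
    Continuous fun x => posPow k (t - distSq q x) :=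
  (continuous_posPow k).comp (continuous_const.sub hq.contDiff_distSq.continuous)

theorem integrable_posPow_mul (hq : IsSLGraph q) {k : ℕ} (hk : k ≠ 0) (t : ℝ)
    {w : (Fin n → ℝ) → ℝ} (hw : Continuous w) :
    Integrable fun x => posPow k (t - distSq q x) * w x :=
  ((hq.continuous_posPow_sub_distSq k t).mul hw).integrable_of_hasCompactSupport
    (hasCompactSupport_posPow q hk t).mul_right

theorem hasDerivAt_integral_posPow (hq : IsSLGraph q) {w : (Fin n → ℝ) → ℝ} (hw : Continuous w)
    (t : ℝ) : HasDerivAt (fun t => ∫ x, posPow 2 (t - distSq q x) * w x)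
      (2 * ∫ x, posPow 1 (t - distSq q x) * w x) t := by
  have h := hasDerivAt_integral_of_dominated_loc_of_deriv_le (μ := (volume : Measure (Fin n → ℝ)))
    (F := fun t x => posPow 2 (t - distSq q x) * w x)
    (F' := fun t x => 2 * (posPow 1 (t - distSq q x) * w x)) (x₀ := t)
    (s := Metric.ball t 1) (bound := fun x => 2 * (posPow 1 (t + 1 - distSq q x) * |w x|))
    (Metric.ball_mem_nhds t one_pos)
    (Filter.Eventually.of_forall fun t =>
      ((hq.continuous_posPow_sub_distSq 2 t).mul hw).aestronglyMeasurable)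
    (hq.integrable_posPow_mul (by simp) t hw)
    (((hq.continuous_posPow_sub_distSq 1 t).mul hw).const_mul 2).aestronglyMeasurable
    (Filter.Eventually.of_forall fun x t' ht' => by
      rw [Real.norm_eq_abs, abs_mul, abs_mul, abs_two, abs_of_nonneg (posPow_nonneg _ _)]
      have : t' ≤ t + 1 := by
        rw [Metric.mem_ball, Real.dist_eq] at ht'
        linarith [(abs_lt.1 ht').2]
      have := posPow_mono 1 (show t' - distSq q x ≤ t + 1 - distSq q x by linarith)
      gcongr)
    ((hq.integrable_posPow_mul (by simp) (t + 1) hw.abs).const_mul 2)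
    (Filter.Eventually.of_forall fun x t' _ => by
      have := ((hasDerivAt_posPow 0 (t' - distSq q x)).comp t'
        ((hasDerivAt_id t').sub_const (distSq q x))).mul_const (w x)
      refine this.congr_deriv ?_
      simp [mul_assoc])
  rw [← integral_const_mul]
  exact h.2

/-- The truncated averages of `φ` over the intersection of the graph with the ball of radius `r`. -/
noncomputable def _root_.SpecialLagrangian.avg (q : (Fin n → ℝ) → (Fin n → ℝ))
    (φ : (Fin n → ℝ) → ℝ) (r : ℝ) : ℝ :=
  (∫ x, posPow 2 (r ^ 2 - distSq q x) * (φ x * vol q x)) / r ^ (n + 4)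

theorem continuous_lap (hq : IsSLGraph q) {φ : (Fin n → ℝ) → ℝ} (hφ : ContDiff ℝ ∞ φ) :
    Continuous (lap q φ) :=
  continuous_finsetSum _ fun i _ => continuous_finsetSum _ fun j _ =>
    (hq.contDiff_ginv_apply i j).continuous.mul (contDiff_pd (contDiff_pd hφ j) i).continuous

theorem continuous_normalSq (hq : IsSLGraph q) : Continuous (normalSq q) := by
  have h1 := hq.smooth.continuous
  have h2 := hq.contDiff_jac.continuous
  have h3 := hq.contDiff_ginv.continuous
  have h4 : Continuous fun x => q x - jac q x *ᵥ x := h1.sub (h2.matrix_mulVec continuous_id)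
  exact h4.dotProduct (h3.matrix_mulVec h4)

/-- The **monotonicity formula**. -/
theorem hasDerivAt_avg (hq : IsSLGraph q) {φ : (Fin n → ℝ) → ℝ} (hφ : ContDiff ℝ ∞ φ) {r : ℝ}
    (hr : 0 < r) : HasDerivAt (avg q φ)
      (((∫ x, posPow 3 (r ^ 2 - distSq q x) * (lap q φ x * vol q x)) +
        24 * ∫ x, posPow 1 (r ^ 2 - distSq q x) * (normalSq q x * (φ x * vol q x))) /
        (6 * r ^ (n + 5))) r := by
  have hV := hq.contDiff_vol.continuous
  have hw : Continuous fun x => φ x * vol q x := hφ.continuous.mul hV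
  have hd := (hq.hasDerivAt_integral_posPow hw (r ^ 2)).comp r (hasDerivAt_pow 2 r)
  have hd2 := hd.div (hasDerivAt_pow (n + 4) r) (by positivity)
  have hs : ContDiff ℝ 1 fun x => r ^ 2 - distSq q x :=
    contDiff_const.sub (hq.contDiff_distSq.of_le (by simp))
  have hs' : Differentiable ℝ (distSq q) := hq.contDiff_distSq.differentiable (by simp)
  have hf' (j : Fin n) : ContDiff ℝ 1 (pd j fun y => posPow 3 (r ^ 2 - distSq q y)) := by
    have : (pd j fun y => posPow 3 (r ^ 2 - distSq q y)) =
      fun y => -3 * posPow 2 (r ^ 2 - distSq q y) * pd j (distSq q) y := by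
      funext y
      have h := (hasDerivAt_posPow 1 (r ^ 2 - distSq q y)).comp (distSq q y)
        ((hasDerivAt_id (distSq q y)).const_sub (r ^ 2))
      rw [pd_comp (h := fun σ => posPow 3 (r ^ 2 - σ)) h (hs' y)]
      push_cast
      ring_nf
    rw [this]
    exact (contDiff_const.mul (contDiff_posPow_two.comp hs)).mul
      ((contDiff_pd hq.contDiff_distSq j).of_le (by simp))
  have green := hq.integral_mul_lap (f := fun y => posPow 3 (r ^ 2 - distSq q y)) (g := φ)
    (contDiff_posPow_three.comp hs) hf' (hasCompactSupport_posPow q (by simp) _)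
    (hφ.of_le (by simp)) (fun j => (contDiff_pd hφ j).of_le (by simp))
  have i1 := hq.integrable_posPow_mul (k := 1) (by simp) (r ^ 2) hw
  have i2 := hq.integrable_posPow_mul (k := 2) (by simp) (r ^ 2) hw
  have i3 : Integrable fun x => posPow 3 (r ^ 2 - distSq q x) * (lap q φ x * vol q x) :=
    hq.integrable_posPow_mul (by simp) (r ^ 2) ((hq.continuous_lap hφ).mul hV)
  have i4 : Integrable fun x => posPow 1 (r ^ 2 - distSq q x) *
      (normalSq q x * (φ x * vol q x)) :=
    hq.integrable_posPow_mul (by simp) (r ^ 2) (hq.continuous_normalSq.mul hw)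
  have e : ∫ x, vol q x * (posPow 3 (r ^ 2 - distSq q x) * lap q φ x -
        φ x * lap q (fun y => posPow 3 (r ^ 2 - distSq q y)) x) =
      ((∫ x, posPow 3 (r ^ 2 - distSq q x) * (lap q φ x * vol q x)) +
        24 * ∫ x, posPow 1 (r ^ 2 - distSq q x) * (normalSq q x * (φ x * vol q x))) -
      (24 * r ^ 2 * (∫ x, posPow 1 (r ^ 2 - distSq q x) * (φ x * vol q x)) -
      (24 + 6 * n) * ∫ x, posPow 2 (r ^ 2 - distSq q x) * (φ x * vol q x)) := by
    rw [← integral_const_mul, ← integral_const_mul, ← integral_const_mul,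
      ← integral_add i3 (i4.const_mul 24), ← integral_sub (i1.const_mul _) (i2.const_mul _)]
    refine Eq.trans (integral_congr_ae (Filter.Eventually.of_forall fun x => ?_))
      (integral_sub (i3.add (i4.const_mul 24)) ((i1.const_mul _).sub (i2.const_mul _)))
    dsimp only
    rw [hq.lap_posPow]
    ring
  rw [green] at e
  rw [eq_of_sub_eq_zero e.symm]
  refine HasDerivAt.congr_deriv (f := avg q φ) hd2 ?_
  have : n + 4 - 1 = n + 3 := rfl
  rw [this]
  simp only [Function.comp]
  push_cast
  field_simp
  ring

end IsSLGraph

end SpecialLagrangian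

namespace SpecialLagrangian

open scoped ContDiff Matrix.Norms.Operator
open MeasureTheory

variable {n : ℕ}

/-- The scale invariant energy of the second fundamental form of the graph of `q`. -/
noncomputable def energy (q : (Fin n → ℝ) → (Fin n → ℝ)) (r : ℝ) : ℝ :=
  (∫ x, posPow 3 (r ^ 2 - distSq q x) * (hessSq q x * vol q x)) / r ^ (n + 4)

namespace IsSLGraph

variable {q : (Fin n → ℝ) → (Fin n → ℝ)}

theorem normalSq_nonneg (hq : IsSLGraph q) (x : Fin n → ℝ) : 0 ≤ normalSq q x := by
  have := (posDef_one_add_mul_self (hq.symm x)).inv.posSemidef.dotProduct_mulVec_nonneg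
    (q x - jac q x *ᵥ x)
  rwa [star_trivial] at this

theorem lap_const (q : (Fin n → ℝ) → (Fin n → ℝ)) (c : ℝ) (x : Fin n → ℝ) :
    lap q (fun _ => c) x = 0 := by
  have h (j : Fin n) (c : ℝ) : pd j (fun _ : Fin n → ℝ => c) = fun _ => 0 := by
    funext y; simp [pd]
  simp [lap, h]

theorem continuous_hessSq (hq : IsSLGraph q) : Continuous (hessSq q) := by
  have (k i j : Fin n) : Continuous fun x => pd k (jac q) x i j :=
    (contDiff_matrix_iff.1 (contDiff_pd hq.contDiff_jac k) i j).continuous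
  unfold hessSq
  fun_prop

theorem hasDerivAt_avg_one (hq : IsSLGraph q) {r : ℝ} (hr : 0 < r) :
    HasDerivAt (avg q fun _ => 1)
      (4 * (∫ x, posPow 1 (r ^ 2 - distSq q x) * (normalSq q x * vol q x)) / r ^ (n + 5)) r := by
  refine (hq.hasDerivAt_avg (contDiff_const (c := (1 : ℝ))) hr).congr_deriv ?_
  simp only [lap_const, zero_mul, mul_zero, integral_zero, one_mul, zero_add]
  field_simp
  ring

theorem monotoneOn_avg_one (hq : IsSLGraph q) : MonotoneOn (avg q fun _ => 1) (Set.Ioi 0) := by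
  refine monotoneOn_of_hasDerivWithinAt_nonneg (convex_Ioi 0)
    (fun r hr => (hq.hasDerivAt_avg_one hr).continuousAt.continuousWithinAt)
    (fun r hr => (hq.hasDerivAt_avg_one (by simpa using hr)).hasDerivWithinAt) fun r hr => ?_
  have hr : 0 < r := by simpa using hr
  have : 0 ≤ ∫ x, posPow 1 (r ^ 2 - distSq q x) * (normalSq q x * vol q x) :=
    integral_nonneg fun x => mul_nonneg (posPow_nonneg _ _)
      (mul_nonneg (hq.normalSq_nonneg x) (hq.vol_pos x).le)
  positivity

theorem energy_le_deriv_avg (hq : IsSLGraph q) {r : ℝ} (hr : 0 < r) :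
    ∃ d, HasDerivAt (avg q (jacSq q)) d r ∧ energy q r / (36 * r) ≤ d := by
  refine ⟨_, hq.hasDerivAt_avg hq.contDiff_jacSq hr, ?_⟩
  have hV := hq.contDiff_vol.continuous
  have h1 : 0 ≤ ∫ x, posPow 1 (r ^ 2 - distSq q x) * (normalSq q x * (jacSq q x * vol q x)) :=
    integral_nonneg fun x => mul_nonneg (posPow_nonneg _ _)
      (mul_nonneg (hq.normalSq_nonneg x) (mul_nonneg (jacSq_nonneg q x) (hq.vol_pos x).le))
  have h2 : 1 / 6 * ∫ x, posPow 3 (r ^ 2 - distSq q x) * (hessSq q x * vol q x) ≤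
      ∫ x, posPow 3 (r ^ 2 - distSq q x) * (lap q (jacSq q) x * vol q x) := by
    rw [← integral_const_mul]
    refine integral_mono
      ((hq.integrable_posPow_mul (by simp) _ (hq.continuous_hessSq.mul hV)).const_mul _)
      (hq.integrable_posPow_mul (by simp) _ ((hq.continuous_lap hq.contDiff_jacSq).mul hV))
      fun x => ?_
    have := mul_le_mul_of_nonneg_left (mul_le_mul_of_nonneg_right (hq.lap_jacSq_ge x)
      (hq.vol_pos x).le) (posPow_nonneg 3 (r ^ 2 - distSq q x))
    refine le_trans (le_of_eq ?_) this
    ring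
  have h3 : energy q r / (36 * r) =
      (1 / 6 * ∫ x, posPow 3 (r ^ 2 - distSq q x) * (hessSq q x * vol q x)) /
        (6 * r ^ (n + 5)) := by
    unfold energy
    field_simp
    ring
  rw [h3]
  gcongr
  linarith

theorem integral_posPow_le (q : (Fin n → ℝ) → (Fin n → ℝ)) {w : (Fin n → ℝ) → ℝ} {C r : ℝ}
    (hr : 0 ≤ r) (hC : 0 ≤ C) (hw : ∀ x, w x ≤ C) :
    ∫ x, posPow 2 (r ^ 2 - distSq q x) * w x ≤ C * 2 ^ n * r ^ (n + 4) := by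
  have hi : Integrable ((Metric.closedBall (0 : Fin n → ℝ) r).indicator
      fun _ => r ^ 4 * C) :=
    (integrable_indicator_iff Metric.isClosed_closedBall.measurableSet).2
      (integrableOn_const (measure_closedBall_lt_top.ne))
  by_cases hi' : Integrable fun x => posPow 2 (r ^ 2 - distSq q x) * w x
  · refine (integral_mono hi' hi fun x => ?_).trans (le_of_eq ?_)
    · by_cases hx : x ∈ Metric.closedBall (0 : Fin n → ℝ) r
      · rw [Set.indicator_of_mem hx]
        have h1 : posPow 2 (r ^ 2 - distSq q x) ≤ r ^ 4 := by
          have h0 : 0 ≤ distSq q x := (sq_nonneg _).trans (norm_sq_le_distSq q x)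
          refine (posPow_mono 2 (sub_le_self _ h0)).trans (le_of_eq ?_)
          rw [posPow_of_nonneg _ (sq_nonneg r)]; ring
        exact (mul_le_mul_of_nonneg_left (hw x) (posPow_nonneg _ _)).trans
          (mul_le_mul_of_nonneg_right h1 hC)
      · rw [Set.indicator_of_notMem hx]
        simp only [posPow_sub_distSq_eq_zero q two_ne_zero hr hx, zero_mul, le_refl]
    · rw [integral_indicator Metric.isClosed_closedBall.measurableSet, setIntegral_const,
        Measure.real, Real.volume_pi_closedBall _ hr, ENNReal.toReal_ofReal (by positivity),
        smul_eq_mul, Fintype.card_fin]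
      ring
  · rw [integral_undef hi']
    positivity

theorem avg_jacSq_le (hq : IsSLGraph q) {r : ℝ} (hr : 0 < r) :
    avg q (jacSq q) r ≤ n * volBound n * 2 ^ n := by
  unfold avg
  rw [div_le_iff₀ (by positivity)]
  exact integral_posPow_le q hr.le (mul_nonneg n.cast_nonneg (Real.sqrt_nonneg _)) fun x =>
    mul_le_mul (hq.jacSq_le x) (hq.vol_le x) (hq.vol_pos x).le n.cast_nonneg

theorem exists_energy_lt (hq : IsSLGraph q) {ε : ℝ} (hε : 0 < ε) (R : ℝ) :
    ∃ r, R < r ∧ 0 < r ∧ energy q r < ε := by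
  by_contra! h
  set a := max R 0 + 1
  have ha : 0 < a := by positivity
  have haR : R < a := (le_max_left R 0).trans_lt (lt_add_one _)
  have hd (r : ℝ) (hr : a ≤ r) : ∃ d,
      HasDerivAt (fun r => avg q (jacSq q) r - ε / 36 * Real.log r) d r ∧ 0 ≤ d := by
    have hr0 := ha.trans_le hr
    obtain ⟨d, h1, h2⟩ := hq.energy_le_deriv_avg hr0
    refine ⟨_, h1.sub ((Real.hasDerivAt_log hr0.ne').const_mul _), ?_⟩
    have h3 := h r (haR.trans_le hr) hr0
    have : ε / 36 * r⁻¹ ≤ energy q r / (36 * r) := by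
      rw [div_mul_eq_mul_div, ← div_eq_mul_inv, div_div, mul_comm r]
      gcongr
    linarith
  choose! d hd1 hd2 using hd
  have mono : MonotoneOn (fun r => avg q (jacSq q) r - ε / 36 * Real.log r) (Set.Ici a) :=
    monotoneOn_of_hasDerivWithinAt_nonneg (convex_Ici a)
      (fun r hr => (hd1 r hr).continuousAt.continuousWithinAt)
      (fun r hr => (hd1 r (interior_subset hr)).hasDerivWithinAt)
      (fun r hr => hd2 r (interior_subset hr))
  set b := avg q (jacSq q) a - ε / 36 * Real.log a
  obtain ⟨r, hr1, hr2⟩ := ((Real.tendsto_log_atTop.eventually_gt_atTop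
    ((n * volBound n * 2 ^ n - b) / (ε / 36))).and (Filter.eventually_ge_atTop a)).exists
  have h1 : b ≤ avg q (jacSq q) r - ε / 36 * Real.log r := mono Set.self_mem_Ici hr2 hr2
  have h2 := hq.avg_jacSq_le (ha.trans_le hr2)
  rw [div_lt_iff₀ (by positivity)] at hr1
  linarith

end IsSLGraph

end SpecialLagrangian

namespace SpecialLagrangian

open scoped ContDiff Matrix.Norms.Operator
open MeasureTheory

variable {n : ℕ}

theorem integral_comp_mulVec {S : Matrix (Fin n) (Fin n) ℝ} (hS : S.det ≠ 0)
    {f : (Fin n → ℝ) → ℝ} (hf : Continuous f) :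
    ∫ z, f (S *ᵥ z) * |S.det| = ∫ z, f z := by
  have h := Real.map_matrix_volume_pi_eq_smul_volume_pi hS
  have hc : Continuous (toLin' S) := (toLin' S).continuous_of_finiteDimensional
  have h2 : ∫ z, f z ∂(Measure.map (toLin' S) volume) = ∫ z, f (S *ᵥ z) := by
    rw [integral_map hc.aemeasurable hf.aestronglyMeasurable]
    rfl
  rw [h, integral_smul_measure, ENNReal.toReal_ofReal (abs_nonneg _), abs_inv] at h2
  rw [integral_mul_const, ← h2, smul_eq_mul]
  field_simp [abs_ne_zero.2 hS]

/-- The normalised average for a flat graph. -/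
noncomputable def flatAvg (n : ℕ) : ℝ := ∫ z : Fin n → ℝ, posPow 2 (1 - z ⬝ᵥ z)

theorem integral_posPow_linear {B : Matrix (Fin n) (Fin n) ℝ} (hB : Bᵀ = B) :
    ∫ z : Fin n → ℝ, posPow 2 (1 - (z ⬝ᵥ z + (B *ᵥ z) ⬝ᵥ (B *ᵥ z))) * √(1 + B * B).det =
      flatAvg n := by
  have hM := posDef_one_add_mul_self hB
  obtain ⟨S, hS⟩ : ∃ S : Matrix (Fin n) (Fin n) ℝ, 1 + B * B = Sᵀ * S := by
    obtain ⟨U, μ, -, h⟩ := exists_one_add_mul_self_eq hB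
    refine ⟨diagonal (fun i => √(1 + μ i * μ i)) * Uᵀ, ?_⟩
    rw [h, transpose_mul, transpose_transpose, diagonal_transpose,
      ← mul_assoc, mul_assoc U (diagonal _) (diagonal _), diagonal_mul_diagonal]
    congr! 4 with i
    rw [Real.mul_self_sqrt (by nlinarith [mul_self_nonneg (μ i)])]
  have hdet : (1 + B * B).det = S.det * S.det := by rw [hS, det_mul, det_transpose]
  have hd : S.det ≠ 0 := by
    intro h
    have := hM.det_pos
    rw [hdet, h, mul_zero] at this
    exact lt_irrefl _ this
  have hz (z : Fin n → ℝ) : z ⬝ᵥ z + (B *ᵥ z) ⬝ᵥ (B *ᵥ z) = (S *ᵥ z) ⬝ᵥ (S *ᵥ z) := by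
    have e1 (C : Matrix (Fin n) (Fin n) ℝ) :
        (C *ᵥ z) ⬝ᵥ (C *ᵥ z) = z ⬝ᵥ ((Cᵀ * C) *ᵥ z) := by
      rw [← mulVec_mulVec, dotProduct_mulVec z, vecMul_transpose]
    rw [e1, e1, ← hS, hB, add_mulVec, one_mulVec, dotProduct_add]
  simp_rw [hz, hdet, Real.sqrt_mul_self_eq_abs]
  exact integral_comp_mulVec hd (f := fun z => posPow 2 (1 - z ⬝ᵥ z))
    ((continuous_posPow 2).comp (by fun_prop))

theorem posPow_mul_of_nonneg (k : ℕ) {a : ℝ} (ha : 0 ≤ a) (x : ℝ) :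
    posPow k (a * x) = a ^ k * posPow k x := by
  rw [posPow, posPow, ← mul_pow, mul_max_of_nonneg _ _ ha, mul_zero]

theorem norm_sq_le_dotProduct_self (z : Fin n → ℝ) : ‖z‖ ^ 2 ≤ z ⬝ᵥ z := by
  simpa [distSq, dotProduct] using IsSLGraph.norm_sq_le_distSq (fun _ => 0) z

namespace IsSLGraph

variable {q : (Fin n → ℝ) → (Fin n → ℝ)}

theorem distSq_smul {r : ℝ} (hr : 0 < r) (z : Fin n → ℝ) :
    r ^ 2 - distSq q (r • z) =
      r ^ 2 * (1 - (z ⬝ᵥ z + (r⁻¹ • q (r • z)) ⬝ᵥ (r⁻¹ • q (r • z)))) := by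
  have h : distSq q (r • z) = (r • z) ⬝ᵥ (r • z) + q (r • z) ⬝ᵥ q (r • z) := by
    simp [distSq, dotProduct, Finset.sum_add_distrib]
  rw [h]
  simp only [smul_dotProduct, dotProduct_smul, smul_eq_mul]
  field_simp

theorem avg_one_eq {r : ℝ} (hr : 0 < r) :
    avg q (fun _ => 1) r =
      ∫ z, posPow 2 (1 - (z ⬝ᵥ z + (r⁻¹ • q (r • z)) ⬝ᵥ (r⁻¹ • q (r • z)))) * vol q (r • z) := by
  have h := Measure.integral_comp_smul (volume : Measure (Fin n → ℝ))
    (fun x => posPow 2 (r ^ 2 - distSq q x) * (1 * vol q x)) r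
  have h1 (z : Fin n → ℝ) : posPow 2 (r ^ 2 - distSq q (r • z)) * (1 * vol q (r • z)) =
      r ^ 4 * (posPow 2 (1 - (z ⬝ᵥ z + (r⁻¹ • q (r • z)) ⬝ᵥ (r⁻¹ • q (r • z)))) *
        vol q (r • z)) := by
    rw [distSq_smul hr]
    rw [posPow_mul_of_nonneg 2 (sq_nonneg r)]
    ring
  simp_rw [h1] at h
  rw [integral_const_mul, Module.finrank_fin_fun, abs_of_pos (by positivity), smul_eq_mul] at h
  rw [avg, div_eq_iff (by positivity), ← mul_right_inj' (a := (r ^ n)⁻¹) (by positivity), ← h]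
  generalize (∫ z, posPow 2 (1 - (z ⬝ᵥ z + (r⁻¹ • q (r • z)) ⬝ᵥ (r⁻¹ • q (r • z)))) *
    vol q (r • z)) = I
  field_simp
  ring

theorem tendsto_avg_one (hq : IsSLGraph q) {r : ℕ → ℝ} (hr : ∀ k, 0 < r k)
    {B : Matrix (Fin n) (Fin n) ℝ} (hB : Bᵀ = B)
    (h : ∀ᵐ z, z ∈ Metric.closedBall (0 : Fin n → ℝ) 1 →
      Filter.Tendsto (fun k => jac q (r k • z)) Filter.atTop (nhds B) ∧
      Filter.Tendsto (fun k => (r k)⁻¹ • q (r k • z)) Filter.atTop (nhds (B *ᵥ z))) :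
    Filter.Tendsto (fun k => avg q (fun _ => 1) (r k)) Filter.atTop (nhds (flatAvg n)) := by
  simp_rw [avg_one_eq (hr _)]
  rw [← integral_posPow_linear hB]
  have hcq := hq.smooth.continuous
  have hcv := hq.contDiff_vol.continuous
  have out (z w : Fin n → ℝ) (hz : z ∉ Metric.closedBall (0 : Fin n → ℝ) 1) :
      posPow 2 (1 - (z ⬝ᵥ z + w ⬝ᵥ w)) = 0 := by
    refine posPow_of_nonpos two_ne_zero ?_
    rw [mem_closedBall_zero_iff, not_le] at hz
    nlinarith [norm_sq_le_dotProduct_self z, (sq_nonneg _).trans (norm_sq_le_dotProduct_self w)]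
  refine tendsto_integral_of_dominated_convergence
    ((Metric.closedBall (0 : Fin n → ℝ) 1).indicator fun _ => volBound n) (fun k => ?_) ?_
    (fun k => ?_) ?_
  · refine Continuous.aestronglyMeasurable ?_
    refine ((continuous_posPow 2).comp ?_).mul (by fun_prop)
    fun_prop
  · exact (integrable_indicator_iff Metric.isClosed_closedBall.measurableSet).2
      (integrableOn_const (measure_closedBall_lt_top.ne))
  · refine Filter.Eventually.of_forall fun z => ?_
    by_cases hz : z ∈ Metric.closedBall (0 : Fin n → ℝ) 1
    · rw [Set.indicator_of_mem hz, Real.norm_eq_abs, abs_mul, abs_of_nonneg (posPow_nonneg _ _),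
        abs_of_pos (hq.vol_pos _), ← one_mul (volBound n)]
      refine mul_le_mul ?_ (hq.vol_le _) (hq.vol_pos _).le zero_le_one
      refine (posPow_mono 2 (y := 1) ?_).trans (by simp [posPow])
      have h1 := (sq_nonneg _).trans (norm_sq_le_dotProduct_self z)
      have h2 := (sq_nonneg _).trans
        (norm_sq_le_dotProduct_self ((r k)⁻¹ • q (r k • z)))
      linarith
    · rw [Set.indicator_of_notMem hz, out _ _ hz]
      simp
  · filter_upwards [h] with z hz
    by_cases hz1 : z ∈ Metric.closedBall (0 : Fin n → ℝ) 1
    · obtain ⟨h1, h2⟩ := hz hz1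
      refine Filter.Tendsto.mul ?_ ?_
      · refine ((continuous_posPow 2).tendsto _).comp ?_
        have : Continuous fun w : Fin n → ℝ => 1 - (z ⬝ᵥ z + w ⬝ᵥ w) := by fun_prop
        exact (this.tendsto _).comp h2
      · have : Continuous fun H : Matrix (Fin n) (Fin n) ℝ => √(1 + H * H).det := by
          fun_prop
        exact (this.tendsto _).comp h1
    · simp only [out _ _ hz1, zero_mul]
      exact tendsto_const_nhds

end IsSLGraph

end SpecialLagrangian

namespace SpecialLagrangian

open scoped ContDiff Matrix.Norms.Operator ENNReal
open MeasureTheory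

variable {n : ℕ}

/-- The closed unit ball of the sup norm. -/
abbrev unitCube (n : ℕ) : Set (Fin n → ℝ) := Metric.closedBall 0 1

theorem setLIntegral_comp_add_smul_le {g : (Fin n → ℝ) → ℝ≥0∞} (hg : Measurable g)
    {a : Fin n → ℝ} {s : ℝ} (hs : 1 / 2 ≤ s) (ha : ∀ x ∈ unitCube n, a + s • x ∈ unitCube n) :
    ∫⁻ x in unitCube n, g (a + s • x) ≤ 2 ^ n * ∫⁻ x in unitCube n, g x := by
  have hQ : MeasurableSet (unitCube n) := Metric.isClosed_closedBall.measurableSet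
  have hs0 : 0 < s := by linarith
  have hG : Measurable (Set.indicator (unitCube n) g) := hg.indicator hQ
  have hG' : Measurable fun x => Set.indicator (unitCube n) g (a + x) :=
    hG.comp (measurable_const_add a)
  calc ∫⁻ x in unitCube n, g (a + s • x)
      = ∫⁻ x in unitCube n, Set.indicator (unitCube n) g (a + s • x) :=
        setLIntegral_congr_fun hQ fun x hx => (Set.indicator_of_mem (ha x hx) g).symm
    _ ≤ ∫⁻ x, Set.indicator (unitCube n) g (a + s • x) := setLIntegral_le_lintegral _ _
    _ = ∫⁻ x, Set.indicator (unitCube n) g (a + x) ∂(Measure.map (s • ·) volume) :=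
        (lintegral_map hG' (measurable_const_smul s)).symm
    _ = ENNReal.ofReal |(s ^ n)⁻¹| * ∫⁻ x in unitCube n, g x := by
        rw [Measure.map_addHaar_smul _ hs0.ne', lintegral_smul_measure, Module.finrank_fin_fun,
          lintegral_add_left_eq_self, lintegral_indicator hQ, smul_eq_mul]
    _ ≤ _ := by
        gcongr
        rw [abs_of_pos (by positivity), ← inv_pow, ENNReal.ofReal_pow (by positivity)]
        gcongr
        rw [show (2 : ℝ≥0∞) = ENNReal.ofReal 2 by simp]
        refine ENNReal.ofReal_le_ofReal ?_
        rw [inv_le_comm₀ hs0 two_pos]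
        linarith

theorem lintegral_lintegral_segment_le {g : (Fin n → ℝ) → ℝ≥0∞} (hg : Measurable g) {t : ℝ}
    (ht : t ∈ Set.Icc (0 : ℝ) 1) :
    ∫⁻ y in unitCube n, ∫⁻ x in unitCube n, g ((1 - t) • y + t • x) ≤
      volume (unitCube n) * (2 ^ n * ∫⁻ x in unitCube n, g x) := by
  have hQ : MeasurableSet (unitCube n) := Metric.isClosed_closedBall.measurableSet
  have hc : Convex ℝ (unitCube n) := convex_closedBall 0 1
  have key (s : ℝ) (hs : 1 / 2 ≤ s) (hs1 : s ≤ 1) :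
      ∫⁻ y in unitCube n, ∫⁻ x in unitCube n, g ((1 - s) • y + s • x) ≤
        volume (unitCube n) * (2 ^ n * ∫⁻ x in unitCube n, g x) := by
    have h (y : Fin n → ℝ) (hy : y ∈ unitCube n) :
        ∫⁻ x in unitCube n, g ((1 - s) • y + s • x) ≤ 2 ^ n * ∫⁻ x in unitCube n, g x :=
      setLIntegral_comp_add_smul_le hg hs fun x hx =>
        hc hy hx (by linarith) (by linarith) (by ring)
    refine (setLIntegral_mono' hQ h).trans ?_
    rw [setLIntegral_const, mul_comm]
  rcases le_total (1 / 2) t with h | h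
  · exact key t h ht.2
  · rw [lintegral_lintegral_swap]
    · refine le_trans (le_of_eq ?_) (key (1 - t) (by linarith) (by linarith [ht.1]))
      refine lintegral_congr fun x => lintegral_congr fun y => ?_
      rw [sub_sub_cancel, add_comm]
    · exact (hg.comp (by fun_prop)).aemeasurable

variable {W : Type*} [NormedAddCommGroup W] [NormedSpace ℝ W]

/-- The **Poincaré inequality** in `L¹` on the unit cube. -/
theorem lintegral_enorm_sub_le {f : (Fin n → ℝ) → W} (hf : ContDiff ℝ 1 f) :
    ∫⁻ y in unitCube n, ∫⁻ x in unitCube n, ‖f x - f y‖ₑ ≤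
      2 * (volume (unitCube n) * (2 ^ n * ∫⁻ x in unitCube n, ‖fderiv ℝ f x‖ₑ)) := by
  have hQ : MeasurableSet (unitCube n) := Metric.isClosed_closedBall.measurableSet
  have hg : Continuous fun x => ‖fderiv ℝ f x‖ₑ := (hf.continuous_fderiv (by simp)).enorm
  have h1 (y : Fin n → ℝ) (hy : y ∈ unitCube n) (x : Fin n → ℝ) (hx : x ∈ unitCube n) :
      ‖f x - f y‖ₑ ≤
        2 * ∫⁻ t in Set.Icc (0 : ℝ) 1, ‖fderiv ℝ f ((1 - t) • y + t • x)‖ₑ := by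
    have hl : ContDiff ℝ 1 fun t : ℝ => (1 - t) • y + t • x := by fun_prop
    have hd (t : ℝ) : HasDerivAt (fun t : ℝ => (1 - t) • y + t • x) (x - y) t := by
      have := (((hasDerivAt_id t).const_sub 1).smul_const y).add ((hasDerivAt_id t).smul_const x)
      refine this.congr_deriv ?_
      rw [neg_one_smul, one_smul]; abel
    have h := enorm_sub_le_lintegral_deriv_of_contDiffOn_Icc (hf.comp hl).contDiffOn
      (zero_le_one (α := ℝ))
    simp only [Function.comp, sub_self, zero_smul, one_smul, zero_add, sub_zero, add_zero] at h
    refine h.trans ?_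
    rw [← lintegral_const_mul' _ _ (by simp)]
    refine lintegral_mono fun t => ?_
    have hdt := ((hf.differentiable (by simp) _).hasFDerivAt.comp_hasDerivAt t (hd t)).deriv
    refine (congrArg enorm hdt).le.trans ?_
    rw [mul_comm]
    have hxy : ‖x - y‖ₑ ≤ 2 := by
      rw [mem_closedBall_zero_iff] at hx hy
      rw [show (2 : ℝ≥0∞) = ENNReal.ofReal 2 by simp, ← ofReal_norm]
      exact ENNReal.ofReal_le_ofReal ((norm_sub_le _ _).trans (by linarith))
    exact (ContinuousLinearMap.le_opENorm _ _).trans (by gcongr)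
  have hm1 : Measurable fun p : ((Fin n → ℝ) × (Fin n → ℝ)) × ℝ =>
      ‖fderiv ℝ f ((1 - p.2) • p.1.1 + p.2 • p.1.2)‖ₑ := (hg.comp (by fun_prop)).measurable
  calc ∫⁻ y in unitCube n, ∫⁻ x in unitCube n, ‖f x - f y‖ₑ
      ≤ ∫⁻ y in unitCube n, ∫⁻ x in unitCube n,
          2 * ∫⁻ t in Set.Icc (0 : ℝ) 1, ‖fderiv ℝ f ((1 - t) • y + t • x)‖ₑ :=
        setLIntegral_mono' hQ fun y hy => setLIntegral_mono' hQ fun x hx => h1 y hy x hx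
    _ = 2 * ∫⁻ t in Set.Icc (0 : ℝ) 1, ∫⁻ y in unitCube n, ∫⁻ x in unitCube n,
          ‖fderiv ℝ f ((1 - t) • y + t • x)‖ₑ := by
        have e (y : Fin n → ℝ) : ∫⁻ x in unitCube n,
            2 * ∫⁻ t in Set.Icc (0 : ℝ) 1, ‖fderiv ℝ f ((1 - t) • y + t • x)‖ₑ =
            2 * ∫⁻ t in Set.Icc (0 : ℝ) 1, ∫⁻ x in unitCube n,
              ‖fderiv ℝ f ((1 - t) • y + t • x)‖ₑ := by
          rw [lintegral_const_mul' _ _ (by simp), lintegral_lintegral_swap]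
          exact (hg.comp (by fun_prop)).aemeasurable
        simp_rw [e]
        rw [lintegral_const_mul' _ _ (by simp), lintegral_lintegral_swap]
        refine Measurable.aemeasurable ?_
        refine Measurable.lintegral_prod_right' (f := fun p : ((Fin n → ℝ) × ℝ) × (Fin n → ℝ) =>
          ‖fderiv ℝ f ((1 - p.1.2) • p.1.1 + p.1.2 • p.2)‖ₑ) ?_
        exact (hg.comp (by fun_prop)).measurable
    _ ≤ 2 * ∫⁻ t in Set.Icc (0 : ℝ) 1,
          volume (unitCube n) * (2 ^ n * ∫⁻ x in unitCube n, ‖fderiv ℝ f x‖ₑ) := by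
        gcongr 2 * ?_
        exact setLIntegral_mono' measurableSet_Icc fun t ht =>
          lintegral_lintegral_segment_le hg.measurable ht
    _ = _ := by rw [setLIntegral_const]; simp

end SpecialLagrangian

namespace SpecialLagrangian

open scoped ContDiff Matrix.Norms.Operator ENNReal
open MeasureTheory

variable {n : ℕ}

theorem norm_clm_le_sum {W : Type*} [NormedAddCommGroup W] [NormedSpace ℝ W]
    (L : (Fin n → ℝ) →L[ℝ] W) : ‖L‖ ≤ ∑ k, ‖L (Pi.single k 1)‖ := by
  refine L.opNorm_le_bound (Finset.sum_nonneg fun _ _ => norm_nonneg _) fun v => ?_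
  have : L v = ∑ k, v k • L (Pi.single k 1) := by
    conv_lhs => rw [← Finset.univ_sum_single v]
    rw [map_sum]
    refine Finset.sum_congr rfl fun k _ => ?_
    rw [← map_smul, ← Pi.single_smul, smul_eq_mul, mul_one]
  rw [this, Finset.sum_mul]
  refine norm_sum_le_of_le _ fun k _ => ?_
  rw [norm_smul, mul_comm]
  exact mul_le_mul_of_nonneg_left (norm_le_pi_norm v k) (norm_nonneg _)

theorem norm_pi_pi_le_sum (A : Fin n → Fin n → ℝ) : ‖A‖ ≤ ∑ i, ∑ j, |A i j| := by
  have h0 (i : Fin n) : 0 ≤ ∑ j, |A i j| := Finset.sum_nonneg fun _ _ => abs_nonneg _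
  refine (pi_norm_le_iff_of_nonneg (Finset.sum_nonneg fun i _ => h0 i)).2 fun i => ?_
  refine le_trans ?_ (Finset.single_le_sum (fun i _ => h0 i) (Finset.mem_univ i))
  refine (pi_norm_le_iff_of_nonneg (h0 i)).2 fun j => ?_
  exact Finset.single_le_sum (f := fun j => |A i j|) (fun _ _ => abs_nonneg _) (Finset.mem_univ j)

theorem pd_comp_smul {f : (Fin n → ℝ) → ℝ} (hf : Differentiable ℝ f) (R : ℝ) (k : Fin n)
    (z : Fin n → ℝ) : pd k (fun z => f (R • z)) z = R * pd k f (R • z) := by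
  have h := (hf (R • z)).hasFDerivAt.comp z ((hasFDerivAt_id z).const_smul R)
  have h2 : fderiv ℝ (fun z => f (R • z)) z = _ := h.fderiv
  rw [pd, h2]
  simp [pd]

/-- A radius ratio for which the graph over the small ball lies well inside the large ball. -/
noncomputable def ballRatio (n : ℕ) : ℝ := 2 * (n + 1) ^ 2

theorem one_le_ballRatio (n : ℕ) : 1 ≤ ballRatio n := by
  have : (1 : ℝ) ≤ (n + 1) ^ 2 := one_le_pow₀ (by simp)
  unfold ballRatio
  linarith

theorem fderiv_eq_jac_mulVec {q : (Fin n → ℝ) → (Fin n → ℝ)} (hq : ContDiff ℝ ∞ q)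
    (hs : ∀ x, (jac q x)ᵀ = jac q x) (x v : Fin n → ℝ) :
    fderiv ℝ q x v = jac q x *ᵥ v := by
  funext j
  have hd : DifferentiableAt ℝ q x := hq.differentiable (by simp) x
  have h1 (k : Fin n) : fderiv ℝ q x (Pi.single k 1) j = jac q x j k := by
    rw [← hs x, transpose_apply]
    simp only [jac, of_apply, pd]
    rw [_root_.fderiv_apply hd]
    rfl
  conv_lhs => rw [← Finset.univ_sum_single v]
  rw [map_sum, Finset.sum_apply, mulVec, dotProduct]
  refine Finset.sum_congr rfl fun k _ => ?_
  rw [← h1, ← mul_one (v k), ← smul_eq_mul, Pi.single_smul, map_smul, Pi.smul_apply, smul_eq_mul,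
    smul_eq_mul, mul_one, mul_comm]

namespace IsSLGraph

variable {q : (Fin n → ℝ) → (Fin n → ℝ)}

theorem fderiv_apply (hq : IsSLGraph q) (x v : Fin n → ℝ) :
    fderiv ℝ q x v = jac q x *ᵥ v :=
  fderiv_eq_jac_mulVec hq.smooth hq.symm x v

theorem norm_jac_mulVec_le (hq : IsSLGraph q) (x v : Fin n → ℝ) : ‖jac q x *ᵥ v‖ ≤ n * ‖v‖ := by
  rw [pi_norm_le_iff_of_nonneg (by positivity)]
  intro j
  rw [mulVec, dotProduct]
  refine (norm_sum_le_of_le _ (f := fun k => jac q x j k * v k) (n := fun _ => ‖v‖)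
    fun k _ => ?_).trans (by simp)
  rw [norm_mul]
  exact (mul_le_mul (hq.abs_jac_le x j k) (norm_le_pi_norm v k) (norm_nonneg _)
    zero_le_one).trans (one_mul _).le

theorem norm_apply_le (hq : IsSLGraph q) (h0 : q 0 = 0) (x : Fin n → ℝ) : ‖q x‖ ≤ n * ‖x‖ := by
  have h := convex_univ.norm_image_sub_le_of_norm_fderiv_le (𝕜 := ℝ) (f := q) (C := n)
    (fun y _ => hq.smooth.differentiable (by simp) y)
    (fun y _ => ContinuousLinearMap.opNorm_le_bound _ n.cast_nonneg fun v => by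
      rw [hq.fderiv_apply]; exact hq.norm_jac_mulVec_le y v)
    (Set.mem_univ 0) (Set.mem_univ x)
  simpa [h0] using h

theorem four_mul_distSq_le (hq : IsSLGraph q) (h0 : q 0 = 0) (x : Fin n → ℝ) :
    4 * distSq q x ≤ (ballRatio n * ‖x‖) ^ 2 := by
  have h (k : Fin n) : x k * x k + q x k * q x k ≤ (1 + n ^ 2) * ‖x‖ ^ 2 := by
    have h1 := norm_le_pi_norm x k
    have h2 := (norm_le_pi_norm (q x) k).trans (hq.norm_apply_le h0 x)
    have h3 := pow_le_pow_left₀ (norm_nonneg _) h1 2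
    have h4 := pow_le_pow_left₀ (norm_nonneg _) h2 2
    rw [Real.norm_eq_abs, sq_abs] at h3 h4
    nlinarith
  have h5 : distSq q x ≤ n * ((1 + n ^ 2) * ‖x‖ ^ 2) := by
    refine (Finset.sum_le_sum fun k _ => h k).trans ?_
    simp
  have h6 : (n : ℝ) * (1 + n ^ 2) ≤ (n + 1) ^ 4 := by
    have : (0 : ℝ) ≤ n := n.cast_nonneg
    nlinarith [pow_nonneg this 3, pow_nonneg this 2, pow_nonneg this 4]
  calc 4 * distSq q x ≤ 4 * ((n * (1 + n ^ 2)) * ‖x‖ ^ 2) := by linarith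
    _ ≤ 4 * ((n + 1) ^ 4 * ‖x‖ ^ 2) := by gcongr
    _ = _ := by unfold ballRatio; ring

theorem integral_hessSq_le (hq : IsSLGraph q) (h0 : q 0 = 0) {R : ℝ} (hR : 0 < R) :
    R ^ 2 * ∫ z in unitCube n, hessSq q (R • z) ≤
      4 * ballRatio n ^ n * energy q (ballRatio n * R) := by
  set L := ballRatio n with hL
  have hL1 : 1 ≤ L := one_le_ballRatio n
  have hL0 : 0 < L := by linarith
  set r := L * R with hr
  have hr0 : 0 < r := by positivity
  have hV := hq.contDiff_vol.continuous
  have hQ : MeasurableSet (unitCube n) := Metric.isClosed_closedBall.measurableSet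
  set P : (Fin n → ℝ) → ℝ := fun x => posPow 3 (r ^ 2 - distSq q x) * (hessSq q x * vol q x)
    with hP
  have hP0 (x : Fin n → ℝ) : 0 ≤ P x := mul_nonneg (posPow_nonneg _ _)
    (mul_nonneg (hessSq_nonneg q x) (hq.vol_pos x).le)
  have hPi : Integrable P := hq.integrable_posPow_mul (by simp) _ (hq.continuous_hessSq.mul hV)
  have hPi' : Integrable fun z => P (R • z) := hPi.comp_smul hR.ne'
  have hc : Continuous fun z => hessSq q (R • z) :=
    hq.continuous_hessSq.comp (continuous_const_smul R)
  have h1 : ∫ z in unitCube n, r ^ 6 / 4 * hessSq q (R • z) ≤ ∫ z, P (R • z) := by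
    refine le_trans (setIntegral_mono_on ?_ hPi'.integrableOn hQ fun z hz => ?_)
      (setIntegral_le_integral hPi' (Filter.Eventually.of_forall fun z => hP0 _))
    · exact (hc.const_mul _).continuousOn.integrableOn_compact (isCompact_closedBall _ _)
    · have hz1 : ‖R • z‖ ≤ R := by
        rw [norm_smul, Real.norm_eq_abs, abs_of_pos hR]
        rw [mem_closedBall_zero_iff] at hz
        nlinarith
      have h2 : 4 * distSq q (R • z) ≤ r ^ 2 :=
        (hq.four_mul_distSq_le h0 _).trans (pow_le_pow_left₀ (by positivity)
          (mul_le_mul_of_nonneg_left hz1 hL0.le) 2)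
      have h3 : r ^ 6 / 4 ≤ posPow 3 (r ^ 2 - distSq q (R • z)) := by
        refine le_trans ?_ (posPow_mono 3 (show 3 / 4 * r ^ 2 ≤ _ by linarith))
        rw [posPow_of_nonneg _ (by positivity)]
        nlinarith [pow_pos hr0 6]
      refine mul_le_mul h3 ?_ (hessSq_nonneg q _) (posPow_nonneg _ _)
      exact le_mul_of_one_le_right (hessSq_nonneg q _) (hq.one_le_vol _)
  have h2 := Measure.integral_comp_smul (volume : Measure (Fin n → ℝ)) P R
  rw [Module.finrank_fin_fun, abs_of_pos (by positivity), smul_eq_mul] at h2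
  have h3 : ∫ x, P x = r ^ (n + 4) * energy q r := by
    rw [energy, mul_div_cancel₀ _ (by positivity)]
  have he : 0 ≤ energy q r := div_nonneg (integral_nonneg hP0) (by positivity)
  rw [integral_const_mul, h2, h3] at h1
  set X := ∫ z in unitCube n, hessSq q (R • z)
  have h4 : L ^ 6 * R ^ 4 * (R ^ 2 * X) ≤ L ^ 6 * R ^ 4 * (4 * L ^ n * energy q r / L ^ 2) := by
    have e1 : L ^ 6 * R ^ 4 * (R ^ 2 * X) = 4 * (r ^ 6 / 4 * X) := by rw [hr]; ring
    have e2 : L ^ 6 * R ^ 4 * (4 * L ^ n * energy q r / L ^ 2) =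
        4 * ((R ^ n)⁻¹ * (r ^ (n + 4) * energy q r)) := by
      generalize energy q r = e
      rw [hr]; field_simp; ring
    rw [e1, e2]; linarith
  refine (le_of_mul_le_mul_left h4 (by positivity)).trans ?_
  exact div_le_self (by positivity) (one_le_pow₀ hL1)

theorem norm_fderiv_jac_le (hq : IsSLGraph q) {R δ : ℝ} (hδ : 0 < δ) (z : Fin n → ℝ) :
    ‖fderiv ℝ (fun z i j => jac q (R • z) i j) z‖ ≤ n ^ 3 * δ + R ^ 2 * hessSq q (R • z) / δ := by
  have key (a : ℝ) : |R * a| ≤ δ + R ^ 2 * (a * a) / δ := by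
    have : δ * |R * a| ≤ δ * (δ + R ^ 2 * (a * a) / δ) := by
      have e : δ * (δ + R ^ 2 * (a * a) / δ) = δ ^ 2 + |R * a| ^ 2 := by
        rw [sq_abs]; field_simp
      rw [e]
      nlinarith [sq_nonneg (δ - |R * a|), sq_nonneg δ, sq_nonneg (|R * a|)]
    exact le_of_mul_le_mul_left this hδ
  refine (norm_clm_le_sum _).trans ?_
  have h1 (k : Fin n) : ‖fderiv ℝ (fun z i j => jac q (R • z) i j) z (Pi.single k 1)‖ ≤
      ∑ i, ∑ j, (δ + R ^ 2 * (pd k (jac q) (R • z) i j * pd k (jac q) (R • z) i j) / δ) := by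
    refine (norm_pi_pi_le_sum _).trans ?_
    refine Finset.sum_le_sum fun i _ => Finset.sum_le_sum fun j _ => ?_
    have he (i j : Fin n) : Differentiable ℝ fun z => jac q z i j :=
      (hq.contDiff_jac_apply i j).differentiable (by simp)
    have hd : DifferentiableAt ℝ (fun z i j => jac q (R • z) i j) z :=
      differentiableAt_pi.2 fun i => differentiableAt_pi.2 fun j =>
        (he i j (R • z)).comp z (differentiableAt_id.const_smul R)
    have h2 : fderiv ℝ (fun z i j => jac q (R • z) i j) z (Pi.single k 1) i j =
        R * pd k (jac q) (R • z) i j := by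
      have h3 := hasFDerivAt_pi'.1 (hasFDerivAt_pi'.1 hd.hasFDerivAt i) j
      have h4 : fderiv ℝ (fun z => jac q (R • z) i j) z = _ := h3.fderiv
      rw [← pd_entry (hq.differentiable_jac _), ← pd_comp_smul (he i j), pd, h4]
      rfl
    rw [h2]
    exact key _
  refine (Finset.sum_le_sum fun k _ => h1 k).trans (le_of_eq ?_)
  simp only [Finset.sum_add_distrib, hessSq, Finset.mul_sum, Finset.sum_div]
  simp
  ring

theorem exists_lintegral_fderiv_jac_le (hq : IsSLGraph q) (h0 : q 0 = 0) {ε : ℝ} (hε : 0 < ε)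
    (R₀ : ℝ) : ∃ R, R₀ < R ∧ 0 < R ∧
      ∫⁻ z in unitCube n, ‖fderiv ℝ (fun z i j => jac q (R • z) i j) z‖ₑ ≤ ENNReal.ofReal ε := by
  set L := ballRatio n with hL
  have hL1 : 1 ≤ L := one_le_ballRatio n
  have hL0 : 0 < L := by linarith
  set δ := ε / (2 * (n ^ 3 * 2 ^ n + 1)) with hδ
  have hδ0 : 0 < δ := by positivity
  obtain ⟨r, hr1, hr0, hr⟩ := hq.exists_energy_lt (ε := δ * ε / (8 * L ^ n)) (by positivity)
    (L * R₀)
  refine ⟨r / L, by rwa [lt_div_iff₀ hL0, mul_comm], by positivity, ?_⟩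
  set R := r / L with hR
  have hR0 : 0 < R := by positivity
  have hLR : L * R = r := by rw [hR]; field_simp
  have hc : Continuous fun z => hessSq q (R • z) :=
    hq.continuous_hessSq.comp (continuous_const_smul R)
  have hi1 : IntegrableOn (fun z => R ^ 2 * hessSq q (R • z) / δ) (unitCube n) :=
    ((hc.const_mul _).div_const _).continuousOn.integrableOn_compact (isCompact_closedBall _ _)
  have hi0 : IntegrableOn (fun _ : Fin n → ℝ => n ^ 3 * δ) (unitCube n) :=
    integrableOn_const (measure_closedBall_lt_top.ne)
  have h1 : ∫⁻ z in unitCube n, ‖fderiv ℝ (fun z i j => jac q (R • z) i j) z‖ₑ ≤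
      ∫⁻ z in unitCube n, ENNReal.ofReal (n ^ 3 * δ + R ^ 2 * hessSq q (R • z) / δ) := by
    refine lintegral_mono fun z => ?_
    rw [← ofReal_norm]
    exact ENNReal.ofReal_le_ofReal (hq.norm_fderiv_jac_le hδ0 z)
  refine h1.trans ?_
  refine (ofReal_integral_eq_lintegral_ofReal (hi0.add hi1) (Filter.Eventually.of_forall fun z =>
    add_nonneg (by positivity) (div_nonneg (mul_nonneg (sq_nonneg _) (hessSq_nonneg q _))
      hδ0.le))).symm.le.trans ?_
  refine ENNReal.ofReal_le_ofReal ?_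
  refine (integral_add hi0 hi1).le.trans ?_
  rw [setIntegral_const, Measure.real, Real.volume_pi_closedBall _ zero_le_one,
    ENNReal.toReal_ofReal (by positivity), integral_div, integral_const_mul, smul_eq_mul,
    Fintype.card_fin, mul_one]
  have h2 := hq.integral_hessSq_le h0 hR0
  rw [← hL, hLR] at h2
  have h3 : (R ^ 2 * ∫ z in unitCube n, hessSq q (R • z)) / δ ≤ ε / 2 := by
    rw [div_le_iff₀ hδ0]
    refine h2.trans ((mul_le_mul_of_nonneg_left hr.le (by positivity)).trans (le_of_eq ?_))
    field_simp; ring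
  have h4 : 2 ^ n * (n ^ 3 * δ) ≤ ε / 2 := by
    have : ε / 2 = (n ^ 3 * 2 ^ n + 1) * δ := by rw [hδ]; field_simp
    rw [this]
    nlinarith
  linarith

end IsSLGraph

end SpecialLagrangian

namespace SpecialLagrangian

open scoped ContDiff Matrix.Norms.Operator ENNReal
open MeasureTheory Filter

variable {n : ℕ}

namespace IsSLGraph

variable {q : (Fin n → ℝ) → (Fin n → ℝ)}

theorem exists_lintegral_jac_sub_le (hq : IsSLGraph q) (h0 : q 0 = 0) (k : ℕ) :
    ∃ R : ℝ, (k : ℝ) < R ∧ 0 < R ∧ ∃ y : Fin n → ℝ,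
      ∫⁻ x in unitCube n, ‖(fun i j => jac q (R • x) i j) - fun i j => jac q y i j‖ₑ ≤
        2 * (2 ^ n * ENNReal.ofReal (1 / (k + 1))) := by
  obtain ⟨R, hR, hR0, h⟩ := hq.exists_lintegral_fderiv_jac_le h0
    (ε := 1 / ((k : ℝ) + 1)) (by positivity) k
  refine ⟨R, hR, hR0, ?_⟩
  have hf : ContDiff ℝ 1 fun z i j => jac q (R • z) i j :=
    contDiff_pi.2 fun i => contDiff_pi.2 fun j =>
      ((hq.contDiff_jac_apply i j).of_le (by simp)).comp (contDiff_id.const_smul R)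
  have hv0 : volume (unitCube n) ≠ 0 := (Metric.measure_closedBall_pos _ _ one_pos).ne'
  have hv1 : volume (unitCube n) ≠ ⊤ := measure_closedBall_lt_top.ne
  have hm : Measurable fun y => ∫⁻ x in unitCube n,
      ‖(fun i j => jac q (R • x) i j) - fun i j => jac q (R • y) i j‖ₑ := by
    refine Measurable.lintegral_prod_right' (f := fun p : (Fin n → ℝ) × (Fin n → ℝ) =>
      ‖(fun i j => jac q (R • p.2) i j) - fun i j => jac q (R • p.1) i j‖ₑ) ?_
    exact ((hf.continuous.comp continuous_snd).sub
      (hf.continuous.comp continuous_fst)).enorm.measurable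
  obtain ⟨y, -, hy⟩ := exists_le_setLAverage hv0 hv1 hm.aemeasurable
  refine ⟨R • y, hy.trans ?_⟩
  rw [setLAverage_eq]
  refine ENNReal.div_le_of_le_mul ?_
  refine (lintegral_enorm_sub_le hf).trans ?_
  rw [mul_comm _ (volume (unitCube n)), mul_left_comm]
  gcongr

theorem exists_tendsto_jac (hq : IsSLGraph q) (h0 : q 0 = 0) :
    ∃ R : ℕ → ℝ, (∀ k, 0 < R k) ∧ Tendsto R atTop atTop ∧
      ∃ B : Matrix (Fin n) (Fin n) ℝ, Bᵀ = B ∧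
        ∀ᵐ z, z ∈ unitCube n → Tendsto (fun k => jac q (R k • z)) atTop (nhds B) := by
  choose R hR hR0 y hy using hq.exists_lintegral_jac_sub_le h0
  set b : ℕ → Fin n → Fin n → ℝ := fun k i j => jac q (y k) i j with hb
  have hbb (k : ℕ) : b k ∈ Metric.closedBall (0 : Fin n → Fin n → ℝ) 1 := by
    rw [mem_closedBall_zero_iff, pi_norm_le_iff_of_nonneg zero_le_one]
    exact fun i => (pi_norm_le_iff_of_nonneg zero_le_one).2 fun j => hq.abs_jac_le _ i j
  obtain ⟨B, -, φ, hφ, hB⟩ := (isCompact_closedBall (0 : Fin n → Fin n → ℝ) 1).tendsto_subseq hbb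
  have hBij (i j : Fin n) : Tendsto (fun k => jac q (y (φ k)) i j) atTop (nhds (B i j)) :=
    tendsto_pi_nhds.1 (tendsto_pi_nhds.1 hB i) j
  have hBs (i j : Fin n) : B i j = B j i := by
    refine tendsto_nhds_unique (hBij i j) ((hBij j i).congr fun k => ?_)
    conv_lhs => rw [← hq.symm, transpose_apply]
  set f : ℕ → (Fin n → ℝ) → Fin n → Fin n → ℝ := fun k z i j => jac q (R (φ k) • z) i j with hf
  have hfc (k : ℕ) : Continuous (f k) := continuous_pi fun i => continuous_pi fun j =>
    (hq.contDiff_jac_apply i j).continuous.comp (continuous_const_smul _)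
  have hle (k : ℕ) : eLpNorm (f k - fun _ => B) 1 (volume.restrict (unitCube n)) ≤
      2 * (2 ^ n * ENNReal.ofReal (1 / (φ k + 1))) + ‖b (φ k) - B‖ₑ * volume (unitCube n) := by
    rw [eLpNorm_one_eq_lintegral_enorm]
    refine le_trans ?_ (add_le_add_left (hy (φ k)) _)
    rw [← setLIntegral_const, ← lintegral_add_right _ measurable_const]
    refine lintegral_mono fun x => ?_
    refine le_trans (le_of_eq ?_) (enorm_add_le _ _)
    rw [hb, Pi.sub_apply, sub_add_sub_cancel]
  have hlim : Tendsto (fun k => eLpNorm (f k - fun _ => B) 1 (volume.restrict (unitCube n)))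
      atTop (nhds 0) := by
    refine tendsto_of_tendsto_of_tendsto_of_le_of_le tendsto_const_nhds ?_ (fun _ => zero_le) hle
    have h1 : Tendsto (fun k => ENNReal.ofReal (1 / ((φ k : ℝ) + 1))) atTop (nhds 0) := by
      rw [← ENNReal.ofReal_zero]
      exact ENNReal.tendsto_ofReal
        ((tendsto_one_div_add_atTop_nhds_zero_nat (𝕜 := ℝ)).comp hφ.tendsto_atTop)
    have h2 : Tendsto (fun k => ‖b (φ k) - B‖ₑ) atTop (nhds 0) := by
      rw [← enorm_zero (E := Fin n → Fin n → ℝ), ← sub_self B]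
      exact (continuous_enorm.tendsto _).comp (hB.sub tendsto_const_nhds)
    have h3 := (ENNReal.Tendsto.const_mul (a := 2)
      (ENNReal.Tendsto.const_mul (a := 2 ^ n) h1 (Or.inr (by simp))) (Or.inr (by simp))).add
      (ENNReal.Tendsto.mul_const h2 (Or.inr (measure_closedBall_lt_top (x := (0 : Fin n → ℝ))
        (r := 1) (μ := volume)).ne))
    simpa using h3
  obtain ⟨ψ, hψ, hae⟩ := (tendstoInMeasure_of_tendsto_eLpNorm one_ne_zero
    (fun k => (hfc k).aestronglyMeasurable) aestronglyMeasurable_const hlim).exists_seq_tendsto_ae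
  rw [ae_restrict_iff' Metric.isClosed_closedBall.measurableSet] at hae
  refine ⟨fun k => R (φ (ψ k)), fun k => hR0 _, ?_, of B, ?_, ?_⟩
  · exact (tendsto_atTop_mono (fun k => (hR k).le) tendsto_natCast_atTop_atTop).comp
      (hφ.tendsto_atTop.comp hψ.tendsto_atTop)
  · ext i j; exact hBs j i
  · filter_upwards [hae] with z hz hzQ
    exact hz hzQ

end IsSLGraph

end SpecialLagrangian

namespace SpecialLagrangian

open scoped ContDiff Matrix.Norms.Operator ENNReal
open MeasureTheory Filter

variable {n : ℕ}

namespace IsSLGraph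

variable {q : (Fin n → ℝ) → (Fin n → ℝ)}

theorem hasDerivAt_apply_smul (hq : IsSLGraph q) (z : Fin n → ℝ) (s : ℝ) :
    HasDerivAt (fun s : ℝ => q (s • z)) (jac q (s • z) *ᵥ z) s := by
  have h := (hq.smooth.differentiable (by simp) (s • z)).hasFDerivAt.comp_hasDerivAt s
    ((hasDerivAt_id s).smul_const z)
  rwa [hq.fderiv_apply, one_smul] at h

theorem inv_smul_apply_eq_integral (hq : IsSLGraph q) (h0 : q 0 = 0) {R : ℝ} (hR : R ≠ 0)
    (z : Fin n → ℝ) : R⁻¹ • q (R • z) = ∫ s in (0 : ℝ)..1, jac q (R • s • z) *ᵥ z := by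
  have hd (s : ℝ) : HasDerivAt (fun s : ℝ => R⁻¹ • q (R • s • z)) (jac q (R • s • z) *ᵥ z) s := by
    have h := (hq.hasDerivAt_apply_smul (R • z) s).const_smul R⁻¹
    simp_rw [smul_comm _ R, mulVec_smul, inv_smul_smul₀ hR] at h
    exact h
  have hc : Continuous fun s : ℝ => jac q (R • s • z) *ᵥ z :=
    Continuous.matrix_mulVec (hq.contDiff_jac.continuous.comp (by fun_prop)) continuous_const
  rw [intervalIntegral.integral_eq_sub_of_hasDerivAt (fun s _ => hd s) (hc.intervalIntegrable _ _)]
  simp [h0]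

theorem ae_tendsto_inv_smul_apply (hq : IsSLGraph q) (h0 : q 0 = 0) {R : ℕ → ℝ}
    (hR : ∀ k, 0 < R k) {B : Matrix (Fin n) (Fin n) ℝ}
    (hB : ∀ᵐ z, z ∈ unitCube n → Tendsto (fun k => jac q (R k • z)) atTop (nhds B)) :
    ∀ᵐ z, z ∈ unitCube n →
      Tendsto (fun k => (R k)⁻¹ • q (R k • z)) atTop (nhds (B *ᵥ z)) := by
  have hT : MeasurableSet {z | Tendsto (fun k i j => jac q (R k • z) i j) atTop
      (nhds fun i j => B i j)} :=
    measurableSet_tendsto _ fun k => Continuous.measurable <|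
      continuous_pi fun i => continuous_pi fun j =>
        (hq.contDiff_jac_apply i j).continuous.comp (continuous_const_smul _)
  have hQ : MeasurableSet (unitCube n) := Metric.isClosed_closedBall.measurableSet
  have hm : MeasurableSet {p : ℝ × (Fin n → ℝ) | p.1 • p.2 ∈ unitCube n →
      Tendsto (fun k => jac q (R k • p.1 • p.2)) atTop (nhds B)} := by
    have hs : Measurable fun p : ℝ × (Fin n → ℝ) => p.1 • p.2 :=
      (continuous_fst.smul continuous_snd).measurable
    exact hs (hQ.imp hT)
  have hae : ∀ᵐ z : Fin n → ℝ, ∀ᵐ s : ℝ, s • z ∈ unitCube n →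
      Tendsto (fun k => jac q (R k • s • z)) atTop (nhds B) := by
    rw [← Measure.ae_ae_comm hm]
    filter_upwards [Measure.ae_ne volume (0 : ℝ)] with s hs
    exact (Measure.quasiMeasurePreserving_smul volume hs).ae hB
  filter_upwards [hae] with z hz hzQ
  rw [mem_closedBall_zero_iff] at hzQ
  simp_rw [hq.inv_smul_apply_eq_integral h0 (hR _).ne']
  have hI : B *ᵥ z = ∫ _ in (0 : ℝ)..1, B *ᵥ z := by simp
  rw [hI]
  refine intervalIntegral.tendsto_integral_filter_of_dominated_convergence (fun _ => n * ‖z‖)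
    (Eventually.of_forall fun k => ?_) (Eventually.of_forall fun k => ?_) (by simp) ?_
  · exact (Continuous.matrix_mulVec (hq.contDiff_jac.continuous.comp (by fun_prop))
      continuous_const).aestronglyMeasurable
  · exact Eventually.of_forall fun s _ => hq.norm_jac_mulVec_le _ _
  · filter_upwards [hz] with s hs hs01
    rw [Set.uIoc_of_le zero_le_one] at hs01
    have hmem : s • z ∈ unitCube n := by
      rw [mem_closedBall_zero_iff, norm_smul, Real.norm_of_nonneg hs01.1.le]
      exact mul_le_one₀ hs01.2 (norm_nonneg _) hzQ
    have hc : Continuous fun A : Matrix (Fin n) (Fin n) ℝ => A *ᵥ z := by fun_prop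
    exact (hc.tendsto B).comp (hs hmem)

theorem avg_one_le (hq : IsSLGraph q) (h0 : q 0 = 0) {r : ℝ} (hr : 0 < r) :
    avg q (fun _ => 1) r ≤ flatAvg n := by
  obtain ⟨R, hR, hlim, B, hBs, hB⟩ := hq.exists_tendsto_jac h0
  have h := tendsto_avg_one hq hR hBs (by
    filter_upwards [hB, hq.ae_tendsto_inv_smul_apply h0 hR hB] with z h1 h2 hz
    exact ⟨h1 hz, h2 hz⟩)
  refine ge_of_tendsto h ?_
  filter_upwards [hlim.eventually_ge_atTop r] with k hk
  exact hq.monotoneOn_avg_one hr (hR k) hk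

theorem tendsto_inv_smul_apply (hq : IsSLGraph q) (h0 : q 0 = 0) (z : Fin n → ℝ) :
    Tendsto (fun s : ℝ => s⁻¹ • q (s • z)) (nhdsWithin 0 (Set.Ioi 0)) (nhds (jac q 0 *ᵥ z)) := by
  have h := hq.hasDerivAt_apply_smul z 0
  rw [hasDerivAt_iff_tendsto_slope_zero, zero_smul] at h
  simp only [zero_add, h0, sub_zero] at h
  exact h.mono_left (nhdsWithin_mono _ fun s hs => ne_of_gt hs)

theorem tendsto_one_div_nhdsGT :
    Tendsto (fun k : ℕ => 1 / ((k : ℝ) + 1)) atTop (nhdsWithin 0 (Set.Ioi 0)) :=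
  tendsto_nhdsWithin_iff.2 ⟨tendsto_one_div_add_atTop_nhds_zero_nat,
    Eventually.of_forall fun k => by rw [Set.mem_Ioi]; positivity⟩

theorem flatAvg_le_avg_one (hq : IsSLGraph q) (h0 : q 0 = 0) {r : ℝ} (hr : 0 < r) :
    flatAvg n ≤ avg q (fun _ => 1) r := by
  have hpos (k : ℕ) : 0 < 1 / ((k : ℝ) + 1) := by positivity
  have h := tendsto_avg_one hq hpos (hq.symm 0) (Eventually.of_forall fun z _ => by
    refine ⟨?_, (hq.tendsto_inv_smul_apply h0 z).comp tendsto_one_div_nhdsGT⟩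
    have hc : Continuous fun s : ℝ => jac q (s • z) := hq.contDiff_jac.continuous.comp (by fun_prop)
    have := (hc.tendsto 0).comp (tendsto_nhdsWithin_iff.1 tendsto_one_div_nhdsGT).1
    rwa [zero_smul] at this)
  refine le_of_tendsto h ?_
  filter_upwards [tendsto_one_div_add_atTop_nhds_zero_nat.eventually_lt_const hr] with k hk
  exact hq.monotoneOn_avg_one (hpos k) hr hk.le

theorem apply_eq_jac_mulVec_self (hq : IsSLGraph q) (h0 : q 0 = 0) (y : Fin n → ℝ) :
    q y = jac q y *ᵥ y := by
  obtain ⟨r, hr0, hr⟩ : ∃ r : ℝ, 0 < r ∧ distSq q y < r ^ 2 := by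
    have := (sq_nonneg _).trans (norm_sq_le_distSq q y)
    exact ⟨distSq q y + 1, by positivity, by nlinarith⟩
  have hconst : avg q (fun _ => 1) =ᶠ[nhds r] fun _ => flatAvg n := by
    filter_upwards [lt_mem_nhds hr0] with s hs
    exact le_antisymm (hq.avg_one_le h0 hs) (hq.flatAvg_le_avg_one h0 hs)
  have hI := ((hq.hasDerivAt_avg_one hr0).congr_of_eventuallyEq hconst.symm).unique
    (hasDerivAt_const r _)
  have hI : ∫ x, posPow 1 (r ^ 2 - distSq q x) * (normalSq q x * vol q x) = 0 := by
    have : r ^ (n + 5) ≠ 0 := by positivity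
    simpa [this] using hI
  have hN : normalSq q y = 0 := by
    by_contra hne
    have hp : posPow 1 (r ^ 2 - distSq q y) ≠ 0 := by
      rw [posPow, max_eq_left (sub_pos.2 hr).le]
      exact pow_ne_zero _ (sub_pos.2 hr).ne'
    refine hI.not_gt ?_
    refine Continuous.integral_pos_of_hasCompactSupport_nonneg_nonzero (x := y)
      ((hq.continuous_posPow_sub_distSq 1 _).mul
        (hq.continuous_normalSq.mul hq.contDiff_vol.continuous))
      (hasCompactSupport_posPow q one_ne_zero _).mul_right (fun x => ?_)
      (mul_ne_zero hp (mul_ne_zero hne (hq.vol_pos y).ne'))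
    exact mul_nonneg (posPow_nonneg _ _) (mul_nonneg (hq.normalSq_nonneg x) (hq.vol_pos x).le)
  by_contra hne
  have := (posDef_one_add_mul_self (hq.symm y)).inv.dotProduct_mulVec_pos (sub_ne_zero.2 hne)
  rw [star_trivial] at this
  exact this.ne' hN

theorem apply_eq_jac_zero_mulVec (hq : IsSLGraph q) (h0 : q 0 = 0) (y : Fin n → ℝ) :
    q y = jac q 0 *ᵥ y := by
  have hd {t : ℝ} (ht : t ≠ 0) : HasDerivAt (fun t : ℝ => t⁻¹ • q (t • y)) 0 t := by
    refine ((hasDerivAt_inv ht).smul (hq.hasDerivAt_apply_smul y t)).congr_deriv ?_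
    rw [hq.apply_eq_jac_mulVec_self h0 (t • y), mulVec_smul, smul_smul, ← add_smul]
    convert zero_smul ℝ _
    field_simp
    ring
  have hc : ∀ t ∈ Set.Ioi (0 : ℝ), t⁻¹ • q (t • y) = q y := fun t ht => by
    have := isOpen_Ioi.is_const_of_deriv_eq_zero isPreconnected_Ioi
      (fun s hs => (hd (ne_of_gt hs)).differentiableAt.differentiableWithinAt)
      (fun s hs => (hd (ne_of_gt hs)).deriv) ht (Set.mem_Ioi.2 one_pos)
    simpa using this
  refine tendsto_nhds_unique ?_ (hq.tendsto_inv_smul_apply h0 y)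
  exact tendsto_const_nhds.congr' (eventually_nhdsWithin_of_forall fun t ht => (hc t ht).symm)

/-- Bernstein theorem for special Lagrangian graphs with bounded slope. -/
theorem jac_eq_jac_zero (hq : IsSLGraph q) (h0 : q 0 = 0) (x : Fin n → ℝ) :
    jac q x = jac q 0 := by
  have hq2 : q = toLin' (jac q 0) := funext fun y => hq.apply_eq_jac_zero_mulVec h0 y
  have h : ∀ v, jac q x *ᵥ v = jac q 0 *ᵥ v := fun v => by
    rw [← hq.fderiv_apply]
    have := (LinearMap.toContinuousLinearMap (toLin' (jac q 0))).hasFDerivAt (x := x)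
    rw [LinearMap.coe_toContinuousLinearMap', ← hq2] at this
    rw [this.fderiv]
    rfl
  exact mulVec_injective (funext h)

end IsSLGraph

end SpecialLagrangian

namespace SpecialLagrangian

open scoped ContDiff Matrix.Norms.Operator
open Complex (I)

variable {n : ℕ}

theorem det_one_add_I_smul {A : Matrix (Fin n) (Fin n) ℝ} (hA : A.IsHermitian) :
    (1 + I • A.map Complex.ofReal).det =
      (∏ i, √(1 + hA.eigenvalues i ^ 2) : ℝ) *
        Complex.exp ((∑ i, Real.arctan (hA.eigenvalues i) : ℝ) * I) := by
  have h1 : (1 + I • A.map Complex.ofReal).det = ∏ i, (1 + I * hA.eigenvalues i) := by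
    have h2 : 1 + I • A.map Complex.ofReal = (-I) • (scalar (Fin n) I - A.map Complex.ofReal) := by
      ext i j
      by_cases h : i = j <;> simp [h, mul_sub]
    rw [h2, det_smul, ← eval_charpoly]
    have h3 := charpoly_map A Complex.ofRealHom
    rw [hA.charpoly_eq] at h3
    have h4 : A.map (Complex.ofRealHom : ℝ → ℂ) = A.map Complex.ofReal := rfl
    rw [← h4, h3, Polynomial.eval_map, Polynomial.eval₂_finsetProd, ← Finset.card_univ,
      ← Finset.prod_const, ← Finset.prod_mul_distrib]
    refine Finset.prod_congr rfl fun i _ => ?_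
    simp [mul_sub]
  have h5 (x : ℝ) : 1 + I * x = √(1 + x ^ 2) * Complex.exp (Real.arctan x * I) := by
    have hp : √(1 + x ^ 2) ≠ 0 := by positivity
    rw [Complex.exp_mul_I, ← Complex.ofReal_cos, ← Complex.ofReal_sin, Real.cos_arctan,
      Real.sin_arctan, mul_add, ← mul_assoc, ← Complex.ofReal_mul, ← Complex.ofReal_mul,
      mul_one_div_cancel hp, mul_div_cancel₀ _ hp]
    simp [mul_comm]
  rw [h1]
  simp_rw [h5]
  rw [Finset.prod_mul_distrib, ← Complex.exp_sum, Complex.ofReal_prod, Complex.ofReal_sum,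
    Finset.sum_mul]

theorem adjugate_one_add_I_smul {A : Matrix (Fin n) (Fin n) ℝ} (hA : Aᵀ = A) :
    (1 + I • A.map Complex.ofReal).adjugate = (1 + I • A.map Complex.ofReal).det •
      ((1 - I • A.map Complex.ofReal) * (1 + A * A)⁻¹.map Complex.ofReal) := by
  have hG : (1 + A.map Complex.ofReal * A.map Complex.ofReal) *
      (1 + A * A)⁻¹.map Complex.ofReal = 1 := by
    have h := congrArg (fun M : Matrix (Fin n) (Fin n) ℝ => M.map Complex.ofRealHom)
      (mul_nonsing_inv (1 + A * A) ((isUnit_iff_isUnit_det _).1 (isUnit_one_add_mul_self hA)))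
    simp only [Matrix.map_mul, Matrix.map_one, map_zero, map_one] at h
    rw [Matrix.map_add _ (map_add _), Matrix.map_mul,
      Matrix.map_one _ (map_zero _) (map_one _)] at h
    exact h
  generalize A.map Complex.ofReal = C at *
  generalize (1 + A * A)⁻¹.map Complex.ofReal = G at *
  have h2 : (1 + I • C) * (1 - I • C) = 1 + C * C := by
    have h3 : I • C * I • C = -(C * C) := by
      rw [smul_mul_smul_comm, Complex.I_mul_I, neg_smul, one_smul]
    rw [add_mul, mul_sub, mul_sub, h3, one_mul, one_mul, mul_one]
    abel
  calc (1 + I • C).adjugate = (1 + I • C).adjugate * ((1 + I • C) * ((1 - I • C) * G)) := by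
        rw [← mul_assoc (1 + I • C), h2, hG, mul_one]
    _ = _ := by
        rw [← mul_assoc, adjugate_mul, smul_mul_assoc, one_mul]

/-- The special Lagrangian equation, differentiated. -/
theorem trace_eq_zero_of_sum_arctan {A : ℝ → Matrix (Fin n) (Fin n) ℝ}
    {A' : Matrix (Fin n) (Fin n) ℝ} {t Θ : ℝ} (hA : ∀ s, (A s).IsHermitian)
    (hΘ : ∀ s, ∑ i, Real.arctan ((hA s).eigenvalues i) = Θ)
    (hd : ∀ i j, HasDerivAt (fun s => A s i j) (A' i j) t) :
    trace ((1 + A t * A t)⁻¹ * A') = 0 := by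
  have hAt : (A t)ᵀ = A t := hA t
  set ρ : ℝ → ℝ := fun s => ∏ i, √(1 + (hA s).eigenvalues i ^ 2)
  have hρ : ρ t ≠ 0 := Finset.prod_ne_zero_iff.2 fun i _ => by positivity
  have hdet (s : ℝ) : (1 + I • (A s).map Complex.ofReal).det = ρ s * Complex.exp (Θ * I) := by
    rw [det_one_add_I_smul (hA s), hΘ]
  have hD : HasDerivAt (fun s => (1 + I • (A s).map Complex.ofReal).det)
      (trace ((1 + I • (A t).map Complex.ofReal).adjugate * (I • A'.map Complex.ofReal))) t := by
    refine hasDerivAt_det fun i j => ?_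
    exact (((hd i j).ofReal_comp).const_mul I).const_add _
  have hD2 := (hD.mul_const (Complex.exp (-(Θ * I))))
  have hr (s : ℝ) : (1 + I • (A s).map Complex.ofReal).det * Complex.exp (-(Θ * I)) = ρ s := by
    rw [hdet, mul_assoc, ← Complex.exp_add, add_neg_cancel, Complex.exp_zero, mul_one]
  simp_rw [hr] at hD2
  have him : HasDerivAt (fun _ : ℝ => (0 : ℝ)) _ t :=
    Complex.imCLM.hasFDerivAt.comp_hasDerivAt t hD2
  have h0 := him.unique (hasDerivAt_const t 0)
  rw [adjugate_one_add_I_smul hAt, smul_mul_assoc, trace_smul, smul_eq_mul, mul_right_comm, hr]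
    at h0
  have h1 : (1 - I • (A t).map Complex.ofReal) * (1 + A t * A t)⁻¹.map Complex.ofReal *
      (I • A'.map Complex.ofReal) = I • ((1 + A t * A t)⁻¹ * A').map Complex.ofReal +
        (A t * (1 + A t * A t)⁻¹ * A').map Complex.ofReal := by
    have hm (M N : Matrix (Fin n) (Fin n) ℝ) :
        (M * N).map Complex.ofReal = M.map Complex.ofReal * N.map Complex.ofReal :=
      Matrix.map_mul (f := Complex.ofRealHom)
    rw [hm, hm, hm]
    simp only [sub_mul, one_mul, smul_mul_assoc, mul_smul_comm, smul_sub, smul_smul,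
      Complex.I_mul_I]
    module
  have htr (M : Matrix (Fin n) (Fin n) ℝ) : trace (M.map Complex.ofReal) = (trace M : ℝ) := by
    simp [trace]
  rw [h1, trace_add, trace_smul, htr, htr] at h0
  simpa [hρ] using h0

end SpecialLagrangian

namespace SpecialLagrangian

open scoped ContDiff Matrix.Norms.Operator

variable {n : ℕ}

/-- The graph of `p` is a special Lagrangian submanifold of `ℝⁿ × ℝⁿ`, and `p` is the gradient
of a convex function. -/
structure IsConvexSLGraph (p : (Fin n → ℝ) → (Fin n → ℝ)) : Prop where
  smooth : ContDiff ℝ ∞ p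
  posSemidef : ∀ x, (jac p x).PosSemidef
  minimal : ∀ k x, trace ((1 + jac p x * jac p x)⁻¹ * pd k (jac p) x) = 0

theorem contDiff_jac {p : (Fin n → ℝ) → (Fin n → ℝ)} (hp : ContDiff ℝ ∞ p) :
    ContDiff ℝ ∞ (jac p) :=
  contDiff_matrix_iff.2 fun i j => contDiff_pd (contDiff_pi.1 hp j) i

theorem pd_comp_map {W : Type*} [NormedAddCommGroup W] [NormedSpace ℝ W] {f : (Fin n → ℝ) → W}
    {ψ : (Fin n → ℝ) → (Fin n → ℝ)} {y : Fin n → ℝ} (hf : DifferentiableAt ℝ f (ψ y))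
    (hψ : DifferentiableAt ℝ ψ y) (k : Fin n) :
    pd k (fun y => f (ψ y)) y = ∑ l, jac ψ y k l • pd l f (ψ y) := by
  have h : fderiv ℝ ψ y (Pi.single k 1) = ∑ l, jac ψ y k l • Pi.single l (1 : ℝ) := by
    rw [← Finset.univ_sum_single (fderiv ℝ ψ y (Pi.single k 1))]
    refine Finset.sum_congr rfl fun l _ => ?_
    rw [← Pi.single_smul, smul_eq_mul, mul_one]
    congr 1
    simp only [jac, of_apply, pd]
    rw [_root_.fderiv_apply hψ]
    rfl
  have h2 : HasFDerivAt (fun y => f (ψ y)) ((fderiv ℝ f (ψ y)).comp (fderiv ℝ ψ y)) y :=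
    hf.hasFDerivAt.comp y hψ.hasFDerivAt
  rw [pd, h2.fderiv, ContinuousLinearMap.comp_apply, h, map_sum]
  simp_rw [map_smul]
  rfl

theorem dotProduct_le_norm_mul_norm (v w : Fin n → ℝ) : v ⬝ᵥ w ≤ n * ‖v‖ * ‖w‖ := by
  refine (le_abs_self _).trans ((Finset.abs_sum_le_sum_abs _ _).trans ?_)
  refine (Finset.sum_le_sum fun i _ => ?_).trans (b := ∑ _ : Fin n, ‖v‖ * ‖w‖) (by simp [mul_assoc])
  rw [abs_mul]
  exact mul_le_mul (norm_le_pi_norm v i) (norm_le_pi_norm w i) (abs_nonneg _) (norm_nonneg _)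

namespace IsConvexSLGraph

variable {p : (Fin n → ℝ) → (Fin n → ℝ)}

theorem symm (hp : IsConvexSLGraph p) (x : Fin n → ℝ) : (jac p x)ᵀ = jac p x :=
  (hp.posSemidef x).isHermitian

theorem posDef_one_add_jac (hp : IsConvexSLGraph p) (x : Fin n → ℝ) : (1 + jac p x).PosDef :=
  Matrix.PosDef.one.add_posSemidef (hp.posSemidef x)

theorem isUnit_det_one_add_jac (hp : IsConvexSLGraph p) (x : Fin n → ℝ) :
    IsUnit (1 + jac p x).det :=
  (isUnit_iff_isUnit_det _).1 (hp.posDef_one_add_jac x).isUnit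

theorem hasFDerivAt_add (hp : IsConvexSLGraph p) (x : Fin n → ℝ) :
    HasFDerivAt (fun x => x + p x) (toLin' (1 + jac p x)).toContinuousLinearMap x := by
  refine ((hasFDerivAt_id x).add
    (hp.smooth.differentiable (by simp) x).hasFDerivAt).congr_fderiv ?_
  ext1 v
  simp [fderiv_eq_jac_mulVec hp.smooth hp.symm]

theorem hasFDerivAt_add_equiv (hp : IsConvexSLGraph p) (x : Fin n → ℝ) :
    ∃ e : (Fin n → ℝ) ≃L[ℝ] (Fin n → ℝ),
      HasFDerivAt (fun x => x + p x) (e : (Fin n → ℝ) →L[ℝ] (Fin n → ℝ)) x := by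
  have h := hp.isUnit_det_one_add_jac x
  refine ⟨(toLin'OfInv (nonsing_inv_mul _ h) (mul_nonsing_inv _ h)).toContinuousLinearEquiv,
    (hp.hasFDerivAt_add x).congr_fderiv ?_⟩
  rfl

theorem contDiff_add (hp : IsConvexSLGraph p) : ContDiff ℝ ∞ fun x => x + p x :=
  contDiff_id.add hp.smooth

theorem dotProduct_self_le (hp : IsConvexSLGraph p) (x y : Fin n → ℝ) :
    (x - y) ⬝ᵥ (x - y) ≤ ((x + p x) - (y + p y)) ⬝ᵥ (x - y) := by
  set w := x - y with hw
  let L : (Fin n → ℝ) →L[ℝ] ℝ :=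
    (LinearMap.toContinuousLinearMap ((dotProductBilin ℝ ℝ).flip w))
  have hL (v : Fin n → ℝ) : L v = v ⬝ᵥ w := rfl
  have hd (t : ℝ) : HasDerivAt (fun t : ℝ => L ((y + t • w) + p (y + t • w)) - t * (w ⬝ᵥ w))
      ((jac p (y + t • w) *ᵥ w) ⬝ᵥ w) t := by
    have h1 : HasDerivAt (fun t : ℝ => y + t • w) w t := by
      simpa using ((hasDerivAt_id t).smul_const w).const_add y
    have h2 := L.hasFDerivAt.comp_hasDerivAt t
      ((hp.hasFDerivAt_add (y + t • w)).comp_hasDerivAt t h1)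
    refine (h2.sub ((hasDerivAt_id t).mul_const (w ⬝ᵥ w))).congr_deriv ?_
    simp [hL]
  have hmono := monotone_of_hasDerivAt_nonneg hd fun t => by
    have := (hp.posSemidef (y + t • w)).dotProduct_mulVec_nonneg w
    rwa [star_trivial, dotProduct_comm] at this
  have := hmono zero_le_one
  simp only [zero_smul, add_zero, one_smul, zero_mul, sub_zero, one_mul, hL] at this
  rw [show y + w = x by simp [hw]] at this
  rw [sub_dotProduct (x + p x)]
  linarith

theorem antilipschitz_add (hp : IsConvexSLGraph p) :
    AntilipschitzWith n (fun x => x + p x) := by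
  refine AntilipschitzWith.of_le_mul_dist fun x y => ?_
  rw [dist_eq_norm, dist_eq_norm, NNReal.coe_natCast]
  have h := (norm_sq_le_dotProduct_self (x - y)).trans ((hp.dotProduct_self_le x y).trans
    (dotProduct_le_norm_mul_norm _ _))
  rw [sq] at h
  rcases (norm_nonneg (x - y)).eq_or_lt with h0 | h0
  · rw [← h0]; positivity
  · exact le_of_mul_le_mul_right h h0

theorem isOpenMap_add (hp : IsConvexSLGraph p) : IsOpenMap fun x => x + p x := by
  rw [isOpenMap_iff_nhds_le]
  intro x
  obtain ⟨e, he⟩ := hp.hasFDerivAt_add_equiv x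
  exact (hp.contDiff_add.contDiffAt.hasStrictFDerivAt' he (by simp)).map_nhds_eq_of_equiv.ge

theorem surjective_add (hp : IsConvexSLGraph p) : Function.Surjective fun x => x + p x := by
  have hclosed : IsClosedMap fun x => x + p x := by
    refine (isProperMap_iff_tendsto_cocompact.2 ⟨hp.contDiff_add.continuous, ?_⟩).isClosedMap
    rw [← Metric.cobounded_eq_cocompact]
    exact hp.antilipschitz_add.tendsto_cobounded
  rw [← Set.range_eq_univ]
  exact IsClopen.eq_univ ⟨hclosed.isClosed_range, hp.isOpenMap_add.isOpen_range⟩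
    (Set.range_nonempty _)

/-- The inverse of `x ↦ x + p x`. -/
theorem exists_inverse (hp : IsConvexSLGraph p) :
    ∃ ψ : (Fin n → ℝ) → (Fin n → ℝ), ContDiff ℝ ∞ ψ ∧ Function.Surjective ψ ∧
      ∀ y, ψ y + p (ψ y) = y := by
  let e := (Equiv.ofBijective _ ⟨hp.antilipschitz_add.injective,
    hp.surjective_add⟩).toHomeomorphOfContinuousOpen hp.contDiff_add.continuous hp.isOpenMap_add
  choose e' he' using hp.hasFDerivAt_add_equiv
  exact ⟨e.symm, e.contDiff_symm he' hp.contDiff_add, e.symm.surjective, e.apply_symm_apply⟩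

theorem jac_inverse (hp : IsConvexSLGraph p) {ψ : (Fin n → ℝ) → (Fin n → ℝ)}
    (hψ : ContDiff ℝ ∞ ψ) (h : ∀ y, ψ y + p (ψ y) = y) (y : Fin n → ℝ) :
    jac ψ y = (1 + jac p (ψ y))⁻¹ := by
  refine (inv_eq_left_inv ?_).symm
  have hψd : DifferentiableAt ℝ ψ y := hψ.differentiable (by simp) y
  ext k j
  have hpd : DifferentiableAt ℝ (fun x => p x j) (ψ y) :=
    (contDiff_pi.1 hp.smooth j).differentiable (by simp) _
  have hψj : DifferentiableAt ℝ (fun x => ψ x j) y :=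
    (contDiff_pi.1 hψ j).differentiable (by simp) _
  have h1 : pd k (fun y => ψ y j + p (ψ y) j) y = jac ψ y k j + (jac ψ y * jac p (ψ y)) k j := by
    have h2 := pd_comp_map hpd hψd k
    rw [mul_apply]
    simp only [smul_eq_mul] at h2
    have h3 : DifferentiableAt ℝ (fun y => p (ψ y) j) y := hpd.comp y hψd
    rw [pd, fderiv_fun_add hψj h3]
    exact congrArg _ h2
  rw [mul_add, mul_one, Matrix.add_apply, ← h1]
  have h4 (y : Fin n → ℝ) : ψ y j + p (ψ y) j = y j := congrFun (h y) j
  simp_rw [h4]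
  rw [IsSLGraph.pd_apply_self, Matrix.one_apply]

end IsConvexSLGraph

end SpecialLagrangian

namespace SpecialLagrangian

open scoped ContDiff Matrix.Norms.Operator

variable {n : ℕ}

theorem jac_sub_two_smul {ψ : (Fin n → ℝ) → (Fin n → ℝ)} (hψ : ContDiff ℝ ∞ ψ) (c : Fin n → ℝ)
    (y : Fin n → ℝ) :
    jac (fun y => y - (2 : ℝ) • (ψ y - c)) y = 1 - (2 : ℝ) • jac ψ y := by
  ext i j
  have hj : DifferentiableAt ℝ (fun x => ψ x j) y :=
    (contDiff_pi.1 hψ j).differentiable (by simp) _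
  have hc : DifferentiableAt ℝ (fun x : Fin n → ℝ => x j) y :=
    (IsSLGraph.contDiff_coord j).differentiable (by simp) _
  have h1 := (hc.hasFDerivAt.sub ((hj.hasFDerivAt.sub_const (c j)).const_mul 2)).fderiv
  have h2 := IsSLGraph.pd_apply_self i j y
  rw [pd] at h2
  change fderiv ℝ (fun y => y j - 2 * (ψ y j - c j)) y _ = _
  have h3 : fderiv ℝ (fun y => y j - 2 * (ψ y j - c j)) y = _ := h1
  rw [h3, _root_.sub_apply, h2, Matrix.sub_apply, Matrix.one_apply]
  rfl

/-- The algebra of the Lewy transformation, which rotates the slope matrix `A` to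
`1 - 2 (1 + A)⁻¹`. -/
theorem one_add_mul_self_lewy {A K : Matrix (Fin n) (Fin n) ℝ} (h1 : K * (1 + A) = 1)
    (h2 : (1 + A) * K = 1) :
    1 + (1 - (2 : ℝ) • K) * (1 - (2 : ℝ) • K) = (2 : ℝ) • (K * (1 + A * A) * K) := by
  have e1 : K * A = 1 - K := by rw [← h1]; noncomm_ring
  have e2 : A * K = 1 - K := by rw [← h2]; noncomm_ring
  have e3 : K * (1 + A * A) * K = K * K + (K * A) * (A * K) := by noncomm_ring
  rw [e3, e1, e2, two_smul ℝ K, two_smul ℝ]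
  noncomm_ring

theorem one_sub_mul_self_lewy {A K : Matrix (Fin n) (Fin n) ℝ} (h2 : (1 + A) * K = 1) :
    1 - (1 - (2 : ℝ) • K) * (1 - (2 : ℝ) • K) = (4 : ℝ) • (K * A * K) := by
  have e2 : A * K = 1 - K := by rw [← h2]; noncomm_ring
  rw [mul_assoc, e2]
  simp only [mul_sub, sub_mul, smul_mul_assoc, mul_smul_comm, one_mul, mul_one]
  module

theorem trace_lewy {A K T : Matrix (Fin n) (Fin n) ℝ} (h1 : K * (1 + A) = 1)
    (h2 : (1 + A) * K = 1) (hA : Aᵀ = A) :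
    trace ((1 + (1 - (2 : ℝ) • K) * (1 - (2 : ℝ) • K))⁻¹ * ((2 : ℝ) • (K * T * K))) =
      trace ((1 + A * A)⁻¹ * T) := by
  have hu := (isUnit_iff_isUnit_det _).1 (isUnit_one_add_mul_self hA)
  have hinv : (1 + (1 - (2 : ℝ) • K) * (1 - (2 : ℝ) • K))⁻¹ =
      (2⁻¹ : ℝ) • ((1 + A) * (1 + A * A)⁻¹ * (1 + A)) := by
    refine inv_eq_left_inv ?_
    rw [one_add_mul_self_lewy h1 h2, smul_mul_smul_comm, inv_mul_cancel₀ two_ne_zero, one_smul]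
    calc (1 + A) * (1 + A * A)⁻¹ * (1 + A) * (K * (1 + A * A) * K)
        = (1 + A) * ((1 + A * A)⁻¹ * (((1 + A) * K) * (1 + A * A))) * K := by
          simp only [mul_assoc]
      _ = 1 := by rw [h2, one_mul, nonsing_inv_mul _ hu, mul_one, h2]
  rw [hinv, smul_mul_smul_comm, inv_mul_cancel₀ two_ne_zero, one_smul]
  calc trace ((1 + A) * (1 + A * A)⁻¹ * (1 + A) * (K * T * K))
      = trace ((1 + A) * (((1 + A * A)⁻¹ * (((1 + A) * K) * T)) * K)) := by
        simp only [mul_assoc]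
    _ = trace ((1 + A * A)⁻¹ * T) := by
        rw [trace_mul_comm, mul_assoc, h1, h2, one_mul, mul_one]

namespace IsConvexSLGraph

variable {p : (Fin n → ℝ) → (Fin n → ℝ)}

theorem isSLGraph_lewy (hp : IsConvexSLGraph p) {ψ : (Fin n → ℝ) → (Fin n → ℝ)}
    (hψ : ContDiff ℝ ∞ ψ) (h : ∀ y, ψ y + p (ψ y) = y) (c : Fin n → ℝ) :
    IsSLGraph fun y => y - (2 : ℝ) • (ψ y - c) := by
  have hK := hp.jac_inverse hψ h
  have hKs (y : Fin n → ℝ) : (jac ψ y)ᵀ = jac ψ y := by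
    rw [hK, transpose_nonsing_inv, transpose_add, transpose_one, hp.symm]
  have h1 (y : Fin n → ℝ) : jac ψ y * (1 + jac p (ψ y)) = 1 := by
    rw [hK, nonsing_inv_mul _ (hp.isUnit_det_one_add_jac _)]
  have h2 (y : Fin n → ℝ) : (1 + jac p (ψ y)) * jac ψ y = 1 := by
    rw [hK, mul_nonsing_inv _ (hp.isUnit_det_one_add_jac _)]
  have hJ : jac (fun y => y - (2 : ℝ) • (ψ y - c)) = fun y => 1 - (2 : ℝ) • jac ψ y :=
    funext (jac_sub_two_smul hψ c)
  refine ⟨contDiff_id.sub ((hψ.sub contDiff_const).const_smul 2), fun y => ?_, fun y => ?_,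
    fun k y => ?_⟩
  · rw [hJ, transpose_sub, transpose_one, transpose_smul, hKs]
  · rw [hJ]
    simp only
    rw [one_sub_mul_self_lewy (h2 y)]
    refine Matrix.PosSemidef.smul ?_ (by norm_num)
    have := (hp.posSemidef (ψ y)).mul_mul_conjTranspose_same (jac ψ y)
    rwa [conjTranspose_eq_transpose_of_trivial, hKs] at this
  · have hA : DifferentiableAt ℝ (jac p) (ψ y) :=
      (contDiff_jac hp.smooth).differentiable (by simp) _
    have hψd : DifferentiableAt ℝ ψ y := hψ.differentiable (by simp) y
    have hpdK : pd k (jac ψ) y =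
        - (jac ψ y * (∑ l, jac ψ y k l • pd l (jac p) (ψ y)) * jac ψ y) := by
      have hM : ContDiff ℝ ∞ fun y => 1 + jac p (ψ y) :=
        contDiff_const.add ((contDiff_jac hp.smooth).comp hψ)
      have hfun : jac ψ = fun y => (1 + jac p (ψ y))⁻¹ := funext hK
      conv_lhs => rw [hfun]
      rw [pd_matrix_inv hM fun y => (hp.posDef_one_add_jac (ψ y)).isUnit, ← hK,
        ← pd_comp_map hA hψd]
      congr 3
      unfold pd
      rw [fderiv_const_add]
    have hpd : pd k (fun y => 1 - (2 : ℝ) • jac ψ y) y =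
        (2 : ℝ) • (jac ψ y * (∑ l, jac ψ y k l • pd l (jac p) (ψ y)) * jac ψ y) := by
      have hKd : DifferentiableAt ℝ (jac ψ) y := (contDiff_jac hψ).differentiable (by simp) _
      have : pd k (fun y => 1 - (2 : ℝ) • jac ψ y) y = -((2 : ℝ) • pd k (jac ψ) y) := by
        unfold pd
        rw [fderiv_const_sub, fderiv_fun_const_smul hKd]
        rfl
      rw [this, hpdK, smul_neg, neg_neg]
    rw [hJ]
    simp only
    rw [hpd, trace_lewy (h1 y) (h2 y) (hp.symm _), Finset.mul_sum, trace_sum]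
    refine Finset.sum_eq_zero fun l _ => ?_
    rw [mul_smul_comm, trace_smul, hp.minimal, smul_zero]

/-- Bernstein theorem for convex special Lagrangian graphs. -/
theorem jac_eq_jac_zero (hp : IsConvexSLGraph p) (x : Fin n → ℝ) : jac p x = jac p 0 := by
  obtain ⟨ψ, hψ, hsurj, h⟩ := hp.exists_inverse
  have hq := hp.isSLGraph_lewy hψ h (ψ 0)
  have hK (y : Fin n → ℝ) : jac ψ y = jac ψ 0 := by
    have := hq.jac_eq_jac_zero (by simp) y
    rw [jac_sub_two_smul hψ, jac_sub_two_smul hψ] at this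
    exact smul_right_injective _ two_ne_zero (sub_right_injective this)
  have hA (y : Fin n → ℝ) : jac p (ψ y) = (jac ψ 0)⁻¹ - 1 := by
    rw [← hK y, hp.jac_inverse hψ h, nonsing_inv_nonsing_inv _ (hp.isUnit_det_one_add_jac _),
      add_sub_cancel_left]
  obtain ⟨y, rfl⟩ := hsurj x
  obtain ⟨z, hz⟩ := hsurj 0
  rw [← hz, hA, hA]

end IsConvexSLGraph

end SpecialLagrangian

namespace SpecialLagrangian

open scoped ContDiff Matrix.Norms.Operator

variable {n : ℕ}

theorem isConvexSLGraph_gradient {F : (Fin n → ℝ) → ℝ} (hF : ContDiff ℝ ∞ F)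
    (hsymm : ∀ x, (Hess n F x).IsHermitian) (hconv : ∀ x, (Hess n F x).PosSemidef) {Θ : ℝ}
    (hSLE : ∀ x, ∑ i, Real.arctan ((hsymm x).eigenvalues i) = Θ) :
    IsConvexSLGraph fun x j => pd j F x := by
  have hp : ContDiff ℝ ∞ fun x (j : Fin n) => pd j F x := contDiff_pi.2 fun j => contDiff_pd hF j
  refine ⟨hp, hconv, fun k x => ?_⟩
  have hd : DifferentiableAt ℝ (jac fun x j => pd j F x) x :=
    (contDiff_jac hp).differentiable (by simp) x
  have h := trace_eq_zero_of_sum_arctan (A := fun t : ℝ => Hess n F (x + t • Pi.single k 1))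
    (A' := pd k (jac fun x j => pd j F x) x) (t := 0) (fun _ => hsymm _) (fun _ => hSLE _)
    fun i j => by
      rw [← pd_entry hd]
      exact pd_hasDerivAt (hd.matrix_entry i j) k
  rwa [zero_smul, add_zero] at h

theorem pd_eq_zero_iff {W : Type*} [NormedAddCommGroup W] [NormedSpace ℝ W]
    {f : (Fin n → ℝ) → W} {x : Fin n → ℝ} : (∀ k, pd k f x = 0) ↔ fderiv ℝ f x = 0 := by
  refine ⟨fun h => ?_, fun h k => by rw [pd, h]; rfl⟩
  ext1 v
  rw [← Finset.univ_sum_single v, map_sum]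
  refine Finset.sum_eq_zero fun k _ => ?_
  rw [← mul_one (v k), ← smul_eq_mul, Pi.single_smul, map_smul]
  exact (congrArg _ (h k)).trans (smul_zero _)

theorem eq_of_pd_eq {f g : (Fin n → ℝ) → ℝ} (hf : Differentiable ℝ f) (hg : Differentiable ℝ g)
    (h : ∀ k x, pd k f x = pd k g x) (x : Fin n → ℝ) : f x = g x + (f 0 - g 0) := by
  have h1 : ∀ y, fderiv ℝ (fun y => f y - g y) y = 0 := fun y => by
    rw [← pd_eq_zero_iff]
    intro k
    rw [pd, fderiv_fun_sub (hf y) (hg y), _root_.sub_apply, sub_eq_zero]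
    exact h k y
  have := is_const_of_fderiv_eq_zero (hf.sub hg) h1 x 0
  simp only [Pi.sub_apply] at this
  linarith

theorem exists_eq_quadratic {F : (Fin n → ℝ) → ℝ} (hF : ContDiff ℝ ∞ F)
    {A : Matrix (Fin n) (Fin n) ℝ} (hs : Aᵀ = A) (hA : ∀ x, Hess n F x = A) :
    ∃ (b : Fin n → ℝ) (c : ℝ), ∀ x, F x = (1 / 2) * (x ⬝ᵥ A *ᵥ x) + b ⬝ᵥ x + c := by
  have hcoord (i : Fin n) : Differentiable ℝ fun x : Fin n → ℝ => x i := differentiable_apply i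
  have hlin (b : Fin n → ℝ) : Differentiable ℝ fun x : Fin n → ℝ => b ⬝ᵥ x := by
    unfold dotProduct; fun_prop
  have hpdlin (b : Fin n → ℝ) (k : Fin n) (x : Fin n → ℝ) : pd k (fun x => b ⬝ᵥ x) x = b k := by
    unfold dotProduct
    rw [pd_sum fun i _ => (hcoord i x).const_mul (b i)]
    have (i : Fin n) : pd k (fun x : Fin n → ℝ => b i * x i) x = b i * if k = i then 1 else 0 := by
      rw [pd_mul (differentiableAt_const _) (hcoord i x), IsSLGraph.pd_apply_self]
      simp [pd]
    simp [this]
  have hgrad (j : Fin n) (x : Fin n → ℝ) : pd j F x = A j ⬝ᵥ x + pd j F 0 := by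
    have := eq_of_pd_eq ((contDiff_pd hF j).differentiable (by simp)) (hlin (A j))
      (fun k x => by
        rw [hpdlin, ← hs, transpose_apply, ← hA x]
        rfl) x
    simpa using this
  have hquad (x : Fin n → ℝ) (k : Fin n) :
      pd k (fun x => x ⬝ᵥ A *ᵥ x) x = 2 * (A k ⬝ᵥ x) := by
    have e (y : Fin n → ℝ) : y ⬝ᵥ A *ᵥ y = ∑ i, y i * (A i ⬝ᵥ y) := rfl
    simp_rw [e]
    rw [pd_sum fun i _ => (hcoord i x).fun_mul (hlin (A i) x)]
    have (i : Fin n) : pd k (fun x : Fin n → ℝ => x i * (A i ⬝ᵥ x)) x =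
        A k i * x i + (if k = i then 1 else 0) * (A i ⬝ᵥ x) := by
      rw [pd_mul (hcoord i x) (hlin (A i) x), hpdlin, IsSLGraph.pd_apply_self, mul_comm (x i),
        ← hs, transpose_apply, hs]
    simp only [this, Finset.sum_add_distrib, ite_mul, one_mul, zero_mul, Finset.sum_ite_eq,
      Finset.mem_univ, if_true]
    rw [two_mul]
    rfl
  have hqd : Differentiable ℝ fun x : Fin n → ℝ => x ⬝ᵥ A *ᵥ x := by
    unfold dotProduct mulVec dotProduct; fun_prop
  refine ⟨fun j => pd j F 0, F 0, fun x => ?_⟩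
  have := eq_of_pd_eq (hF.differentiable (by simp))
    ((hqd.const_mul (1 / 2)).fun_add (hlin fun j => pd j F 0)) (fun k x => by
      have e : pd k (fun x => 1 / 2 * (x ⬝ᵥ A *ᵥ x) + (fun j => pd j F 0) ⬝ᵥ x) x =
          1 / 2 * pd k (fun x => x ⬝ᵥ A *ᵥ x) x + pd k (fun x => (fun j => pd j F 0) ⬝ᵥ x) x := by
        rw [pd, fderiv_fun_add ((hqd x).const_mul _) (hlin _ x), fderiv_const_mul (hqd x)]
        rfl
      rw [hgrad, e, hquad, hpdlin]
      ring) x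
  simpa using this

end SpecialLagrangian

/-- **Convex entire solutions are quadratic** (corollary of Theorem A via the Lewy
transformation). If `F : ℝⁿ → ℝ` is a smooth convex function (`D²F(x)` positive
semidefinite for all `x`) solving the special Lagrangian equation
`∑ᵢ arctan λᵢ(x) = Θ`, where `λᵢ(x)` are the eigenvalues of `D²F(x)`, then `F` is a
quadratic polynomial. -/
theorem convex_entire_special_lagrangian_solution_is_quadratic
    (n : ℕ) (hn : 1 ≤ n)
    (F : (Fin n → ℝ) → ℝ) (hF : ContDiff ℝ (⊤ : ℕ∞) F)
    (hsymm : ∀ x, (Hess n F x).IsHermitian)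
    (hconv : ∀ x, (Hess n F x).PosSemidef)
    (Θ : ℝ)
    (hSLE : ∀ x, ∑ i, Real.arctan ((hsymm x).eigenvalues i) = Θ) :
    ∃ (A : Matrix (Fin n) (Fin n) ℝ) (b : Fin n → ℝ) (c : ℝ),
      ∀ x, F x = (1 / 2) * (x ⬝ᵥ A.mulVec x) + b ⬝ᵥ x + c := by
  have h := SpecialLagrangian.isConvexSLGraph_gradient hF hsymm hconv hSLE
  exact ⟨Hess n F 0, SpecialLagrangian.exists_eq_quadratic hF (hsymm 0) h.jac_eq_jac_zero⟩
end

section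
/- Let n ≥ 1 and let λ₁, …, λₙ ∈ ℝ satisfy λᵢ λⱼ ≥ −1 for all i, j. Then for every symmetric 3-tensor h on ℝⁿ, ∑_{i,j,k} h_{ijk}² + ∑_{k,i} λᵢ² h_{iik}² + 2 ∑_{k} ∑_{i<j} λᵢ λⱼ h_{ijk}² ≥ 0. -/
/-- A double sum of a symmetric function splits into its diagonal and twice its upper triangle. -/
theorem sum_sum_eq_diag_add_two_mul_sum_Ioi {n : ℕ} (f : Fin n → Fin n → ℝ)
    (hf : ∀ i j, f i j = f j i) :
    ∑ i, ∑ j, f i j = ∑ i, f i i + 2 * ∑ i, ∑ j ∈ Finset.Ioi i, f i j := by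
  have key := Finset.sum_sum_Ioi_add_eq_sum_sum_off_diag f
  have hl : ∑ i, ∑ j ∈ Finset.Ioi i, (f j i + f i j)
      = 2 * ∑ i, ∑ j ∈ Finset.Ioi i, f i j := by
    simp only [Finset.mul_sum, two_mul]
    exact Finset.sum_congr rfl fun i _ => Finset.sum_congr rfl fun j _ => by rw [hf j i]
  rw [← hl, key, ← Finset.sum_add_distrib]
  refine Finset.sum_congr rfl fun i _ => ?_
  rw [Fintype.sum_eq_add_sum_compl i]
  exact congrArg _ (Finset.sum_congr rfl fun j _ => hf i j)

/-- **Nonnegativity of the curvature quadratic form on `Ξ`** (`Ξ ⊆ 𝔐`, first part).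
If `λ₁, …, λₙ` satisfy `λᵢ λⱼ ≥ -1` for all `i, j`, then for every symmetric
3-tensor `h` on `ℝⁿ`,
`∑_{i,j,k} h_{ijk}² + ∑_{k,i} λᵢ² h_{iik}² + 2 ∑_k ∑_{i<j} λᵢ λⱼ h_{ijk}² ≥ 0`. -/
theorem curvature_form_nonneg_of_eigenvalue_product_bound
    (n : ℕ) (hn : 1 ≤ n) (lam : Fin n → ℝ)
    (hlam : ∀ i j, -1 ≤ lam i * lam j)
    (h : Fin n → Fin n → Fin n → ℝ)
    (hsymm1 : ∀ i j k, h i j k = h j i k)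
    (hsymm2 : ∀ i j k, h i j k = h i k j) :
    0 ≤ (∑ i, ∑ j, ∑ k, (h i j k) ^ 2) + (∑ k, ∑ i, (lam i) ^ 2 * (h i i k) ^ 2)
        + 2 * ∑ k, ∑ i, ∑ j ∈ Finset.Ioi i, lam i * lam j * (h i j k) ^ 2 := by
  have split (k : Fin n) := sum_sum_eq_diag_add_two_mul_sum_Ioi
    (fun i j => lam i * lam j * (h i j k) ^ 2)
    (fun i j => by rw [hsymm1 i j k, mul_comm (lam i)])
  have rotate : ∑ i, ∑ j, ∑ k, (h i j k) ^ 2 = ∑ k, ∑ i, ∑ j, (h i j k) ^ 2 :=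
    Finset.sum_congr rfl fun i _ => Finset.sum_congr rfl fun j _ =>
      Finset.sum_congr rfl fun k _ => by rw [hsymm2 j k i, hsymm1 j i k]
  rw [rotate, Finset.mul_sum, ← Finset.sum_add_distrib, ← Finset.sum_add_distrib]
  refine Finset.sum_nonneg fun k _ => ?_
  have nonneg : 0 ≤ ∑ i, ∑ j, ((h i j k) ^ 2 + lam i * lam j * (h i j k) ^ 2) :=
    Finset.sum_nonneg fun i _ => Finset.sum_nonneg fun j _ => by
      nlinarith [mul_nonneg (neg_le_iff_add_nonneg.mp (hlam i j)) (sq_nonneg (h i j k))]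
  simp only [Finset.sum_add_distrib, split k, ← sq] at nonneg
  linarith
end

section
/- Let λ₁, λ₂ ∈ ℝ satisfy λ₁ λ₂ ≥ −1. Then for every trace-free symmetric 3-tensor h on ℝ², ∑_{i,j,k} h_{ijk}² + ∑_{k,i} λᵢ² h_{iik}² + 2 ∑_{k} λ₁ λ₂ h_{12k}² ≥ ∑_{i,j,k} h_{ijk}² − 2∑_k h_{12k}² + ∑_{k,i} λᵢ² h_{iik}² ≥ 0, and the left-hand quadratic form vanishes only when h = 0. -/
/-- **The two-dimensional curvature quadratic form.** For `λ₁ λ₂ ≥ -1` and any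
trace-free symmetric 3-tensor `h` on `ℝ²`,
`∑_{i,j,k} h_{ijk}² + ∑_{k,i} λᵢ² h_{iik}² + 2 ∑_k λ₁ λ₂ h_{12k}²
  ≥ ∑_{i,j,k} h_{ijk}² - 2 ∑_k h_{12k}² + ∑_{k,i} λᵢ² h_{iik}² ≥ 0`,
and the left-hand quadratic form vanishes only when `h = 0`. -/
theorem two_dim_curvature_form_nonneg_and_definite
    (l1 l2 : ℝ) (hl : -1 ≤ l1 * l2)
    (h : Fin 2 → Fin 2 → Fin 2 → ℝ)
    (hsymm1 : ∀ i j k, h i j k = h j i k)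
    (hsymm2 : ∀ i j k, h i j k = h i k j)
    (htf : ∀ k, h 0 0 k + h 1 1 k = 0) :
    ((∑ i, ∑ j, ∑ k, (h i j k) ^ 2)
        + (∑ k, (l1 ^ 2 * (h 0 0 k) ^ 2 + l2 ^ 2 * (h 1 1 k) ^ 2))
        + 2 * ∑ k, l1 * l2 * (h 0 1 k) ^ 2
      ≥ (∑ i, ∑ j, ∑ k, (h i j k) ^ 2) - 2 * ∑ k, (h 0 1 k) ^ 2
        + (∑ k, (l1 ^ 2 * (h 0 0 k) ^ 2 + l2 ^ 2 * (h 1 1 k) ^ 2))) ∧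
    ((∑ i, ∑ j, ∑ k, (h i j k) ^ 2) - 2 * ∑ k, (h 0 1 k) ^ 2
        + (∑ k, (l1 ^ 2 * (h 0 0 k) ^ 2 + l2 ^ 2 * (h 1 1 k) ^ 2)) ≥ 0) ∧
    ((∑ i, ∑ j, ∑ k, (h i j k) ^ 2)
        + (∑ k, (l1 ^ 2 * (h 0 0 k) ^ 2 + l2 ^ 2 * (h 1 1 k) ^ 2))
        + 2 * ∑ k, l1 * l2 * (h 0 1 k) ^ 2 = 0
      → ∀ i j k, h i j k = 0) := by
  have h010 : h 0 1 0 = h 0 0 1 := hsymm2 0 1 0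
  have h100 : h 1 0 0 = h 0 0 1 := (hsymm1 1 0 0).trans h010
  have h110 : h 1 1 0 = -h 0 0 0 := by linarith [htf 0]
  have h111 : h 1 1 1 = -h 0 0 1 := by linarith [htf 1]
  have h101 : h 1 0 1 = -h 0 0 0 := (hsymm2 1 0 1).trans h110
  have h011 : h 0 1 1 = -h 0 0 0 := (hsymm1 0 1 1).trans h101
  simp only [Fin.sum_univ_two, Fin.forall_fin_two, h010, h100, h110, h111, h101, h011]
  generalize h 0 0 0 = a
  generalize h 0 0 1 = b
  refine ⟨?_, ?_, fun hzero => ?_⟩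
  · nlinarith [mul_nonneg (neg_le_iff_add_nonneg.mp hl) (add_nonneg (sq_nonneg a) (sq_nonneg b))]
  · ring_nf
    positivity
  · have hfactor : (4 + (l1 + l2) ^ 2) * (a ^ 2 + b ^ 2) = 0 := by
      linear_combination hzero
    have hsum : a ^ 2 + b ^ 2 = 0 :=
      (mul_eq_zero.mp hfactor).resolve_left (by positivity)
    have ha : a = 0 := pow_eq_zero_iff two_ne_zero |>.mp (by nlinarith [sq_nonneg a, sq_nonneg b])
    have hb : b = 0 := pow_eq_zero_iff two_ne_zero |>.mp (by nlinarith [sq_nonneg a, sq_nonneg b])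
    simp [ha, hb]
end
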